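/- arXiv:2304.11613 — 3 statements merged into one kernel-verified Lean document; each statement's English description precedes it below -/
import Mathlib

section
/- MTL is strictly less expressive than MSO, even over the class of finitely-branching Kripke trees: MTL ≤ MSO, and there is an MSO sentence that has no equivalent MTL sentence over finitely-branching Kripke trees. -/
/-! ## Trees over ℕ* -/

abbrev Node : Type := List ℕ

/-- `T` is a tree with root `r`: `r ∈ T`, every node extends `r`, and `T` is
prefix-closed above `r`. -/
def IsTreeRooted (T : Set Node) (r : Node) : Prop :=
  r ∈ T ∧ (∀ τ ∈ T, r <+: τ) ∧
    ∀ σ σ' : List ℕ, r ++ σ ∈ T → σ' <+: σ → r ++ σ' ∈ T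

/-- `T ⊆ ℕ*` is a tree. -/
def IsTree (T : Set Node) : Prop := ∃ r : Node, IsTreeRooted T r

/-- `τ'` is a child of `τ` in `T`. -/
def childIn (T : Set Node) (τ τ' : Node) : Prop := τ' ∈ T ∧ ∃ n : ℕ, τ' = τ ++ [n]

/-- every node of `T` has a child in `T`. -/
def NonBlocking (T : Set Node) : Prop := ∀ τ ∈ T, ∃ n : ℕ, τ ++ [n] ∈ T

/-- every node of `T` has finitely many children in `T`. -/
def FinBranching (T : Set Node) : Prop := ∀ τ ∈ T, {τ' : Node | childIn T τ τ'}.Finite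

/-- `S` is a subtree of `T`. -/
def IsSubtree (T S : Set Node) : Prop := S ⊆ T ∧ IsTree S

/-- `P` is a path of `T`: a subtree totally ordered by the child relation
(each node has at most one child in `P`). -/
def IsPathOf (T P : Set Node) : Prop :=
  IsSubtree T P ∧ ∀ τ ∈ P, ∀ n m : ℕ, τ ++ [n] ∈ P → τ ++ [m] ∈ P → n = m

/-- `T` is a chain: a tree in which each node has at most one child. -/
def IsChainTree (T : Set Node) : Prop :=
  IsTree T ∧ ∀ τ ∈ T, ∀ n m : ℕ, τ ++ [n] ∈ T → τ ++ [m] ∈ T → n = m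

/-- `T` is dense: it contains a subtree every node of which has a descendant
in the subtree with at least two distinct children in the subtree. -/
def DenseTree (T : Set Node) : Prop :=
  ∃ S : Set Node, IsSubtree T S ∧ ∀ τ ∈ S, ∃ τ' ∈ S, τ <+: τ' ∧
    ∃ n m : ℕ, n ≠ m ∧ τ' ++ [n] ∈ S ∧ τ' ++ [m] ∈ S

/-- A Kripke tree over `AP`: a non-blocking tree together with a labelling. -/
structure KripkeTree (AP : Type) where
  T : Set Node
  root : Node
  rooted : IsTreeRooted T root
  nonblocking : NonBlocking T
  Lab : Node → Set AP

/-! ## MSOL syntax -/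

inductive MSOL (AP : Type) : Type
  | atom : AP → ℕ → MSOL AP          -- P_a(x)
  | le   : ℕ → ℕ → MSOL AP           -- x ≤ y
  | mem  : ℕ → ℕ → MSOL AP           -- x ∈ X
  | not  : MSOL AP → MSOL AP
  | and  : MSOL AP → MSOL AP → MSOL AP
  | exFO : ℕ → MSOL AP → MSOL AP     -- ∃x. φ
  | exSO : ℕ → MSOL AP → MSOL AP     -- ∃X. φ

namespace MSOL

def freeFO {AP : Type} : MSOL AP → Set ℕ
  | atom _ x => {x}
  | le x y => {x, y}
  | mem x _ => {x}
  | not φ => φ.freeFO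
  | and φ ψ => φ.freeFO ∪ ψ.freeFO
  | exFO x φ => φ.freeFO \ {x}
  | exSO _ φ => φ.freeFO

def freeSO {AP : Type} : MSOL AP → Set ℕ
  | atom _ _ => ∅
  | le _ _ => ∅
  | mem _ X => {X}
  | not φ => φ.freeSO
  | and φ ψ => φ.freeSO ∪ ψ.freeSO
  | exFO _ φ => φ.freeSO
  | exSO X φ => φ.freeSO \ {X}

/-- A sentence is a formula with no free variables. -/
def IsSentence {AP : Type} (φ : MSOL AP) : Prop := φ.freeFO = ∅ ∧ φ.freeSO = ∅

/-- The first-order fragment: no second-order variables. -/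
def IsFO {AP : Type} : MSOL AP → Prop
  | atom _ _ => True
  | le _ _ => True
  | mem _ _ => False
  | not φ => φ.IsFO
  | and φ ψ => φ.IsFO ∧ ψ.IsFO
  | exFO _ φ => φ.IsFO
  | exSO _ _ => False

end MSOL

/-! ## MSOL semantics, parametrized by the range of second-order quantifiers -/

/-- A second-order domain: for each tree, the collection of sets that
second-order quantifiers range over. -/
abbrev SODom : Type := Set Node → Set (Set Node)

def Sat {AP : Type} (D : SODom) (K : KripkeTree AP) :
    (ℕ → Node) → (ℕ → Set Node) → MSOL AP → Prop
  | V1, _,  .atom a x => V1 x ∈ K.T ∧ a ∈ K.Lab (V1 x)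
  | V1, _,  .le x y => V1 x ∈ K.T ∧ V1 y ∈ K.T ∧ V1 x <+: V1 y
  | V1, V2, .mem x X => V1 x ∈ V2 X
  | V1, V2, .not φ => ¬ Sat D K V1 V2 φ
  | V1, V2, .and φ ψ => Sat D K V1 V2 φ ∧ Sat D K V1 V2 ψ
  | V1, V2, .exFO x φ => ∃ τ ∈ K.T, Sat D K (Function.update V1 x τ) V2 φ
  | V1, V2, .exSO X φ => ∃ S ∈ D K.T, Sat D K V1 (Function.update V2 X S) φ

/-- A logic: a syntactic fragment of MSOL together with a second-order domain. -/
structure MLogic (AP : Type) where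
  syn : MSOL AP → Prop
  dom : SODom

namespace MLogic

/-- A Kripke tree satisfies a sentence. -/
def KSat {AP : Type} (L : MLogic AP) (K : KripkeTree AP) (φ : MSOL AP) : Prop :=
  ∃ V1 V2, Sat L.dom K V1 V2 φ

/-- `L ≤ L'` over the class `M`. -/
def Leq {AP : Type} (M : Set (KripkeTree AP)) (L L' : MLogic AP) : Prop :=
  ∀ φ : MSOL AP, φ.IsSentence → L.syn φ →
    ∃ φ' : MSOL AP, φ'.IsSentence ∧ L'.syn φ' ∧
      ∀ K ∈ M, (L.KSat K φ ↔ L'.KSat K φ')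

/-- `L < L'` over the class `M`. -/
def Lt {AP : Type} (M : Set (KripkeTree AP)) (L L' : MLogic AP) : Prop :=
  Leq M L L' ∧ ¬ Leq M L' L

/-- `L ≡ L'` over the class `M`. -/
def EquivExp {AP : Type} (M : Set (KripkeTree AP)) (L L' : MLogic AP) : Prop :=
  Leq M L L' ∧ Leq M L' L

/-- `L` and `L'` are expressively incomparable over the class `M`. -/
def Incomp {AP : Type} (M : Set (KripkeTree AP)) (L L' : MLogic AP) : Prop :=
  ¬ Leq M L L' ∧ ¬ Leq M L' L

end MLogic

/-! ## The concrete logics -/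

def MSOdom : SODom := fun T => {S | S ⊆ T}
def MTLdom : SODom := fun T => {S | S ⊆ T ∧ IsTree S}
def MPLdom : SODom := fun T => {S | IsPathOf T S}
def weakDom (D : SODom) : SODom := fun T => {S | S ∈ D T ∧ S.Finite}
def coweakDom (D : SODom) : SODom := fun T => {S | S ∈ D T ∧ S.Infinite}

def MSO (AP : Type) : MLogic AP := ⟨fun _ => True, MSOdom⟩
def MTL (AP : Type) : MLogic AP := ⟨fun _ => True, MTLdom⟩
def MPL (AP : Type) : MLogic AP := ⟨fun _ => True, MPLdom⟩
def WMSO (AP : Type) : MLogic AP := ⟨fun _ => True, weakDom MSOdom⟩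
def WMTL (AP : Type) : MLogic AP := ⟨fun _ => True, weakDom MTLdom⟩
def WMPL (AP : Type) : MLogic AP := ⟨fun _ => True, weakDom MPLdom⟩
def CoWMSO (AP : Type) : MLogic AP := ⟨fun _ => True, coweakDom MSOdom⟩
def CoWMTL (AP : Type) : MLogic AP := ⟨fun _ => True, coweakDom MTLdom⟩
def CoWMPL (AP : Type) : MLogic AP := ⟨fun _ => True, coweakDom MPLdom⟩
def FOL (AP : Type) : MLogic AP := ⟨MSOL.IsFO, MSOdom⟩

/-! ## Classes of Kripke trees -/

def allKT (AP : Type) : Set (KripkeTree AP) := Set.univ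
def finBrKT (AP : Type) : Set (KripkeTree AP) := {K | FinBranching K.T}
/-- Kripke trees whose underlying tree is an infinite chain
(every node has exactly one child). -/
def chainKT (AP : Type) : Set (KripkeTree AP) :=
  {K | ∀ τ ∈ K.T, ∃! τ' : Node, childIn K.T τ τ'}

/-! ## Helper material -/

theorem isTree_iff (S : Set Node) : IsTree S ↔ ∃ r ∈ S, (∀ τ ∈ S, r <+: τ) ∧
    ∀ σ τ : Node, τ ∈ S → r <+: σ → σ <+: τ → σ ∈ S := by
  constructor
  · rintro ⟨r, h1, h2, h3⟩
    refine ⟨r, h1, h2, ?_⟩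
    rintro σ τ hτ ⟨a, rfl⟩ ⟨b, rfl⟩
    rw [List.append_assoc] at hτ
    exact h3 (a ++ b) a hτ (List.prefix_append _ _)
  · rintro ⟨r, h1, h2, h3⟩
    refine ⟨r, h1, h2, ?_⟩
    intro σ σ' h h'
    exact h3 _ _ h (List.prefix_append _ _) ((List.prefix_append_right_inj r).2 h')

namespace MSOL

def or' {AP : Type} (φ ψ : MSOL AP) : MSOL AP := not (and (not φ) (not ψ))
def imp' {AP : Type} (φ ψ : MSOL AP) : MSOL AP := not (and φ (not ψ))
def all' {AP : Type} (x : ℕ) (φ : MSOL AP) : MSOL AP := not (exFO x (not φ))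

def treeF {AP : Type} (X : ℕ) : MSOL AP :=
  exFO 0 (and (mem 0 X) (and (all' 1 (imp' (mem 1 X) (le 0 1)))
    (all' 1 (all' 2 (imp' (and (mem 2 X) (and (le 0 1) (le 1 2))) (mem 1 X))))))

def tr {AP : Type} : MSOL AP → MSOL AP
  | atom a x => atom a x
  | le x y => le x y
  | mem x X => mem x X
  | not φ => not φ.tr
  | and φ ψ => and φ.tr ψ.tr
  | exFO x φ => exFO x φ.tr
  | exSO X φ => exSO X (and (treeF X) φ.tr)

theorem tr_freeFO {AP : Type} (φ : MSOL AP) : φ.tr.freeFO = φ.freeFO := by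
  induction φ with
  | exSO X φ ih =>
    simp only [tr, freeFO, ih, treeF, all', imp']
    ext y
    simp
    try omega
  | _ => simp_all [tr, freeFO]

theorem tr_freeSO {AP : Type} (φ : MSOL AP) : φ.tr.freeSO = φ.freeSO := by
  induction φ with
  | exSO X φ ih =>
    simp only [tr, freeSO, ih, treeF, all', imp']
    ext y
    simp
    try tauto
  | _ => simp_all [tr, freeSO]

end MSOL

theorem sat_treeF {AP : Type} (D : SODom) (K : KripkeTree AP) (V1 V2) (X : ℕ)
    (h : V2 X ⊆ K.T) : Sat D K V1 V2 (MSOL.treeF X) ↔ IsTree (V2 X) := by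
  rw [isTree_iff]
  simp [MSOL.treeF, MSOL.all', MSOL.imp', Sat, Function.update]
  constructor
  · rintro ⟨r, h0, h1, h2, h3⟩
    refine ⟨r, h1, fun τ hτ => (h2 τ (h hτ) hτ).2.2, ?_⟩
    intro σ τ hτ hr hs
    have hσ : σ ∈ K.T := by
      have := (isTree_iff K.T).1 ⟨_, K.rooted⟩
      obtain ⟨r', a1, a2, a3⟩ := this
      exact a3 σ τ (h hτ) ((a2 r h0).trans hr) hs
    exact h3 σ hσ τ (h hτ) hτ h0 hσ hr hσ (h hτ) hs
  · rintro ⟨r, h1, h2, h3⟩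
    refine ⟨r, h h1, h1, fun τ h' hτ => ⟨h h1, h', h2 τ hτ⟩, ?_⟩
    intro σ _ τ _ hτ _ _ hr _ _ hs
    exact h3 σ τ hτ hr hs

theorem sat_tr {AP : Type} (K : KripkeTree AP) (φ : MSOL AP) : ∀ V1 V2,
    (Sat MTLdom K V1 V2 φ ↔ Sat MSOdom K V1 V2 φ.tr) := by
  induction φ with
  | exSO X φ ih =>
    intro V1 V2
    simp only [Sat, MSOL.tr]
    constructor
    · rintro ⟨S, hS, h⟩
      refine ⟨S, hS.1, ?_, (ih _ _).1 h⟩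
      rw [sat_treeF]
      · simpa using hS.2
      · simpa using hS.1
    · rintro ⟨S, hS, h0, h⟩
      rw [sat_treeF] at h0
      · refine ⟨S, ⟨hS, by simpa using h0⟩, (ih _ _).2 h⟩
      · simpa using (show S ⊆ K.T from hS)
  | _ => intro V1 V2; simp_all [Sat, MSOL.tr]

theorem part1 (AP : Type) : MLogic.Leq (finBrKT AP) (MTL AP) (MSO AP) := by
  intro φ hφ _
  refine ⟨φ.tr, ⟨by rw [MSOL.tr_freeFO]; exact hφ.1, by rw [MSOL.tr_freeSO]; exact hφ.2⟩,
    trivial, ?_⟩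
  intro K _
  simp only [MLogic.KSat, MTL, MSO, sat_tr]

/-! ### The trees -/

def nd (n l : ℕ) : Bool → Node
  | false => List.replicate l 0
  | true => List.replicate n 0 ++ 1 :: List.replicate (l - n - 1) 0

def Ok (n l : ℕ) (s : Bool) : Prop := s = true → n < l

def TT (n : ℕ) : Set Node := {τ | ∃ l s, Ok n l s ∧ τ = nd n l s}

theorem nd_length {n l : ℕ} {s : Bool} (h : Ok n l s) : (nd n l s).length = l := by
  cases s
  · simp [nd]
  · have := h rfl
    simp [nd]; omega

theorem rep_prefix {a b : ℕ} : List.replicate a (0:ℕ) <+: List.replicate b 0 ↔ a ≤ b := by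
  constructor
  · intro h; simpa using h.length_le
  · intro h
    obtain ⟨c, rfl⟩ := Nat.exists_eq_add_of_le h
    rw [List.replicate_add]; exact List.prefix_append _ _

theorem nd_prefix {n l l' : ℕ} {s s' : Bool} (h : Ok n l s) (h' : Ok n l' s') :
    nd n l s <+: nd n l' s' ↔ l ≤ l' ∧ (s = s' ∨ (s = false ∧ l ≤ n)) := by
  cases s <;> cases s'
  · simp [nd, rep_prefix]
  · have := h' rfl
    constructor
    · intro hp
      have hl := hp.length_le
      rw [nd_length h, nd_length h'] at hl
      refine ⟨hl, Or.inr ⟨rfl, ?_⟩⟩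
      by_contra hc
      push Not at hc
      obtain ⟨c, hc'⟩ := Nat.exists_eq_add_of_lt hc
      simp only [nd] at hp
      have e : l = n + (c + 1) := by omega
      rw [e, List.replicate_add, List.prefix_append_right_inj, List.replicate_succ,
        List.cons_prefix_cons] at hp
      simp at hp
    · rintro ⟨_, h1 | ⟨_, h1⟩⟩
      · simp at h1
      · exact (rep_prefix.2 h1).trans (List.prefix_append _ _)
  · simp [nd]
    intro hp
    have : (1:ℕ) ∈ List.replicate l' 0 := hp.subset (by simp)
    simp at this
  · have := h' rfl
    have := h rfl
    simp [nd, List.prefix_append_right_inj, List.cons_prefix_cons, rep_prefix]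
    omega

theorem nd_inj {n l l' : ℕ} {s s' : Bool} (h : Ok n l s) (h' : Ok n l' s')
    (e : nd n l s = nd n l' s') : l = l' ∧ s = s' := by
  have h1 := (nd_prefix h h').1 (e ▸ List.prefix_refl _)
  have h2 := (nd_prefix h' h).1 (e ▸ List.prefix_refl _)
  refine ⟨le_antisymm h1.1 h2.1, ?_⟩
  unfold Ok at *
  cases s <;> cases s' <;> simp_all <;> omega

theorem TT_prefix {n : ℕ} {σ τ : Node} (hτ : τ ∈ TT n) (h : σ <+: τ) : σ ∈ TT n := by
  obtain ⟨l, s, ok, rfl⟩ := hτ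
  have key : ∃ s', Ok n σ.length s' ∧ nd n σ.length s' <+: nd n l s := by
    have hl := h.length_le
    rw [nd_length ok] at hl
    by_cases hc : σ.length ≤ n
    · refine ⟨false, by simp [Ok], ?_⟩
      rw [nd_prefix (by simp [Ok]) ok]
      exact ⟨hl, Or.inr ⟨rfl, hc⟩⟩
    · refine ⟨s, fun _ => by omega, ?_⟩
      rw [nd_prefix (fun _ => by omega) ok]
      exact ⟨hl, Or.inl rfl⟩
  obtain ⟨s', ok', hp⟩ := key
  refine ⟨_, s', ok', ?_⟩
  exact (List.prefix_of_prefix_length_le h hp (by rw [nd_length ok'])).eq_of_length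
    (by rw [nd_length ok'])

theorem nil_mem (n : ℕ) : ([] : Node) ∈ TT n := ⟨0, false, by simp [Ok], by simp [nd]⟩

def KK (AP : Type) (n : ℕ) : KripkeTree AP where
  T := TT n
  root := []
  rooted := ⟨nil_mem n, fun τ _ => List.nil_prefix, fun σ σ' h h' => TT_prefix h (by simpa using h')⟩
  nonblocking := by
    rintro τ ⟨l, s, ok, rfl⟩
    refine ⟨0, l + 1, s, fun h => by have := ok h; omega, ?_⟩
    cases s
    · simp [nd, List.replicate_succ']
    · have := ok rfl
      have e : l + 1 - n - 1 = (l - n - 1) + 1 := by omega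
      simp [nd, e, List.replicate_succ']
  Lab := fun _ => ∅

theorem KK_fin (AP : Type) (n : ℕ) : KK AP n ∈ finBrKT AP := by
  intro τ _
  refine Set.Finite.subset (((Set.finite_singleton false).insert true).image
    (fun s => nd n (τ.length + 1) s)) ?_
  rintro _ ⟨⟨l, s, ok, e⟩, k, rfl⟩
  refine ⟨s, by cases s <;> simp, ?_⟩
  have := congrArg List.length e
  rw [nd_length ok] at this
  simp at this
  simp only [this, e]

/-! ### Subtrees -/

def SS (n u : ℕ) (v : Bool → ℕ) (i : Bool → Bool) : Set Node :=
  {τ | ∃ l s, Ok n l s ∧ τ = nd n l s ∧ u ≤ l ∧ (l < v s ∨ i s = true)}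

theorem mem_SS {n l u : ℕ} {s : Bool} {v i} (ok : Ok n l s) :
    nd n l s ∈ SS n u v i ↔ u ≤ l ∧ (l < v s ∨ i s = true) := by
  constructor
  · rintro ⟨l', s', ok', e, h⟩
    obtain ⟨rfl, rfl⟩ := nd_inj ok ok' e
    exact h
  · intro h; exact ⟨l, s, ok, rfl, h⟩

def Vd (n u : ℕ) (v : Bool → ℕ) (i : Bool → Bool) : Prop :=
  (u ≤ n ∧ (n < v false ∨ i false = true)) ∨
  (v true ≤ u ∧ i true = false ∧ (u < v false ∨ i false = true)) ∨
  (v false ≤ u ∧ i false = false ∧ n < u ∧ (u < v true ∨ i true = true))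

theorem SS_dom {n u v i} (h : Vd n u v i) : SS n u v i ∈ MTLdom (TT n) := by
  refine ⟨fun τ ⟨l, s, ok, e, _⟩ => ⟨l, s, ok, e⟩, ?_⟩
  rw [isTree_iff]
  have key : ∃ s, Ok n u s ∧ nd n u s ∈ SS n u v i ∧
      (∀ l' s', Ok n l' s' → u ≤ l' → (l' < v s' ∨ i s' = true) → (s = s' ∨ (s = false ∧ u ≤ n)))
      ∧ (∀ l' s' l'' s'', Ok n l' s' → u ≤ l' → (s = s' ∨ (s = false ∧ u ≤ n)) →
        l' ≤ l'' → (s' = s'' ∨ (s' = false ∧ l' ≤ n)) →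
        (l'' < v s'' ∨ i s'' = true) → Ok n l'' s'' → (l' < v s' ∨ i s' = true)) := by
    rcases h with h | h | h
    · refine ⟨false, by simp [Ok], ?_, ?_, ?_⟩
      · rw [mem_SS (by simp [Ok])]; refine ⟨le_rfl, ?_⟩
        rcases h with ⟨h1, h2 | h2⟩
        · left; omega
        · exact Or.inr h2
      · intro l' s' _ _ _; right; exact ⟨rfl, h.1⟩
      · intro l' s' l'' s'' _ _ _ hl hs h' _
        rcases hs with rfl | ⟨rfl, hs⟩
        · rcases h' with h' | h'
          · left; omega
          · exact Or.inr h'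
        · rcases h with ⟨h1, h2 | h2⟩
          · left; omega
          · exact Or.inr h2
    · have aux : ∀ l' s', u ≤ l' → (l' < v s' ∨ i s' = true) → s' = false := by
        intro l' s' h1 h2
        cases s'
        · rfl
        · simp [h.2.1] at h2; omega
      refine ⟨false, by simp [Ok], ?_, ?_, ?_⟩
      · rw [mem_SS (by simp [Ok])]; exact ⟨le_rfl, h.2.2⟩
      · intro l' s' _ h1 h2; left; exact (aux l' s' h1 h2).symm
      · intro l' s' l'' s'' _ hu _ hl hs h' _
        have := aux l'' s'' (by omega) h'
        subst this
        have : s' = false := by tauto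
        subst this
        rcases h' with h' | h'
        · left; omega
        · exact Or.inr h'
    · have aux : ∀ l' s', u ≤ l' → (l' < v s' ∨ i s' = true) → s' = true := by
        intro l' s' h1 h2
        cases s'
        · simp [h.2.1] at h2; omega
        · rfl
      refine ⟨true, fun _ => h.2.2.1, ?_, ?_, ?_⟩
      · rw [mem_SS (fun _ => h.2.2.1)]; exact ⟨le_rfl, h.2.2.2⟩
      · intro l' s' _ h1 h2; left; exact (aux l' s' h1 h2).symm
      · intro l' s' l'' s'' _ hu hq hl hs h' _
        have : s' = true := by simpa [eq_comm] using hq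
        subst this
        have : s'' = true := by simpa [eq_comm] using hs
        subst this
        rcases h' with h' | h'
        · left; omega
        · exact Or.inr h'
  obtain ⟨s, ok, h1, h2, h3⟩ := key
  refine ⟨_, h1, ?_, ?_⟩
  · rintro _ ⟨l', s', ok', rfl, h4, h5⟩
    rw [nd_prefix ok ok']
    exact ⟨h4, h2 l' s' ok' h4 h5⟩
  · rintro σ _ ⟨l'', s'', ok'', rfl, h4, h5⟩ hr hs
    obtain ⟨l', s', ok', rfl⟩ : σ ∈ TT n := TT_prefix ⟨l'', s'', ok'', rfl⟩ hs
    rw [nd_prefix ok ok'] at hr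
    rw [nd_prefix ok' ok''] at hs
    rw [mem_SS ok']
    exact ⟨hr.1, h3 l' s' l'' s'' ok' hr.1 hr.2 hs.1 hs.2 h5 ok''⟩

theorem cut (u : ℕ) (A : ℕ → Prop) (h2 : ∀ l, A l → ∀ l', u ≤ l' → l' ≤ l → A l') :
    ∃ (v : ℕ) (i : Bool), ∀ l, u ≤ l → (A l ↔ (l < v ∨ i = true)) := by
  classical
  by_cases h : ∃ v, u ≤ v ∧ ¬ A v
  · refine ⟨Nat.find h, false, fun l hl => ?_⟩
    have hs := Nat.find_spec h
    constructor
    · intro ha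
      left
      by_contra hc
      exact hs.2 (h2 l ha _ hs.1 (by omega))
    · rintro (hlt | hf)
      · have := Nat.find_min h hlt
        tauto
      · simp at hf
  · push Not at h
    exact ⟨0, true, fun l hl => by simp [h l hl]⟩

theorem dom_SS {n : ℕ} {S : Set Node} (h : S ∈ MTLdom (TT n)) :
    ∃ u v i, Vd n u v i ∧ S = SS n u v i := by
  obtain ⟨hT, ht⟩ := h
  rw [isTree_iff] at ht
  obtain ⟨r, hr, hmin, hcl⟩ := ht
  obtain ⟨u, s, ok, rfl⟩ := hT hr
  -- reformulate
  have hmin' : ∀ l' s', Ok n l' s' → nd n l' s' ∈ S → u ≤ l' ∧ (s = s' ∨ (s = false ∧ u ≤ n)) :=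
    fun l' s' ok' h' => (nd_prefix ok ok').1 (hmin _ h')
  have hcl' : ∀ l' s' l'' s'', Ok n l' s' → Ok n l'' s'' → nd n l'' s'' ∈ S → u ≤ l' →
      (s = s' ∨ (s = false ∧ u ≤ n)) → l' ≤ l'' → (s' = s'' ∨ (s' = false ∧ l' ≤ n)) →
      nd n l' s' ∈ S := fun l' s' l'' s'' ok' ok'' h' a b c d =>
    hcl _ _ h' ((nd_prefix ok ok').2 ⟨a, b⟩) ((nd_prefix ok' ok'').2 ⟨c, d⟩)
  have fin : ∀ v i, (∀ l s', Ok n l s' → (nd n l s' ∈ S ↔ u ≤ l ∧ (l < v s' ∨ i s' = true))) →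
      S = SS n u v i := by
    intro v i hh
    ext τ
    constructor
    · intro hτ
      obtain ⟨l, s', ok', rfl⟩ := hT hτ
      rw [mem_SS ok', ← hh l s' ok']; exact hτ
    · rintro ⟨l, s', ok', rfl, h'⟩
      rw [hh l s' ok']; exact h'
  have okf : ∀ l, Ok n l false := fun l => by simp [Ok]
  cases s
  · obtain ⟨v0, i0, h0⟩ := cut u (fun l => nd n l false ∈ S) (fun l hl l' hu hl' =>
      hcl' l' false l false (okf _) (okf _) hl hu (Or.inl rfl) hl' (Or.inl rfl))
    by_cases hn : u ≤ n ∧ nd n n false ∈ S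
    · obtain ⟨v1, i1, h1⟩ := cut (n+1) (fun l => nd n l true ∈ S ∧ n < l) (fun l hl l' hu hl' =>
        ⟨hcl' l' true l true (fun _ => hu) (fun _ => hl.2) hl.1 (by omega) (Or.inr ⟨rfl, hn.1⟩) hl'
          (Or.inl rfl), hu⟩)
      refine ⟨u, fun s => cond s v1 v0, fun s => cond s i1 i0,
        Or.inl ⟨hn.1, (h0 n hn.1).1 hn.2⟩, fin _ _ ?_⟩
      intro l s' ok'
      cases s'
      · constructor
        · intro h; exact ⟨(hmin' _ _ ok' h).1, (h0 l (hmin' _ _ ok' h).1).1 h⟩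
        · rintro ⟨a, b⟩; exact (h0 l a).2 b
      · have hl := ok' rfl
        constructor
        · intro h; exact ⟨by omega, (h1 l hl).1 ⟨h, hl⟩⟩
        · rintro ⟨a, b⟩; exact ((h1 l hl).2 b).1
    · refine ⟨u, fun s => cond s 0 v0, fun s => cond s false i0,
        Or.inr (Or.inl ⟨by simp, rfl, (h0 u le_rfl).1 hr⟩), fin _ _ ?_⟩
      intro l s' ok'
      cases s'
      · constructor
        · intro h; exact ⟨(hmin' _ _ ok' h).1, (h0 l (hmin' _ _ ok' h).1).1 h⟩
        · rintro ⟨a, b⟩; exact (h0 l a).2 b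
      · have hl := ok' rfl
        simp
        intro h
        have := hmin' _ _ ok' h
        simp at this
        exact absurd ⟨this.2, hcl' n false l true (okf _) ok' h this.2 (Or.inl rfl) hl.le
          (Or.inr ⟨rfl, le_rfl⟩)⟩ hn
  · have hu := ok rfl
    obtain ⟨v1, i1, h1⟩ := cut u (fun l => nd n l true ∈ S ∧ n < l) (fun l hl l' hu' hl' =>
        ⟨hcl' l' true l true (fun _ => by omega) (fun _ => hl.2) hl.1 (by omega) (Or.inl rfl) hl'
          (Or.inl rfl), by omega⟩)
    refine ⟨u, fun s => cond s v1 0, fun s => cond s i1 false,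
        Or.inr (Or.inr ⟨by simp, rfl, hu, (h1 u le_rfl).1 ⟨hr, hu⟩⟩), fin _ _ ?_⟩
    intro l s' ok'
    cases s'
    · simp
      intro h
      have := hmin' _ _ ok' h
      simp at this
    · have hl := ok' rfl
      constructor
      · intro h
        have := (hmin' _ _ ok' h).1
        exact ⟨this, (h1 l this).1 ⟨h, hl⟩⟩
      · rintro ⟨a, b⟩; exact ((h1 l a).2 b).1

/-! ### Back and forth -/

def Good (N : ℕ) (R : ℕ → ℕ → Prop) : Prop :=
  ∀ a b a' b', R a b → R a' b' → ∀ d ≤ N, (a + d ≤ a' ↔ b + d ≤ b')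

def ext (R : ℕ → ℕ → Prop) (p q : ℕ) : ℕ → ℕ → Prop := fun a b => R a b ∨ (a = p ∧ b = q)

theorem Good.swap {N R} (h : Good N R) : Good N (fun a b => R b a) :=
  fun a b a' b' h1 h2 d hd => (h b a b' a' h1 h2 d hd).symm

theorem Good.mono {N M R} (h : Good N R) (hM : M ≤ N) : Good M R :=
  fun a b a' b' h1 h2 d hd => h a b a' b' h1 h2 d (hd.trans hM)

theorem good_ext {N : ℕ} {R} {p q : ℕ} (hR : Good N R)
    (h : ∀ a b, R a b → ∀ d ≤ N, (a + d ≤ p ↔ b + d ≤ q) ∧ (p + d ≤ a ↔ q + d ≤ b)) :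
    Good N (ext R p q) := by
  rintro a b a' b' (h1 | ⟨rfl, rfl⟩) (h2 | ⟨rfl, rfl⟩) d hd
  · exact hR a b a' b' h1 h2 d hd
  · exact (h a b h1 d hd).1
  · exact (h _ _ h2 d hd).2
  · simp

theorem extend {N : ℕ} (hN : 1 ≤ N) {R} (hR : Good (2 * N) R) (h0 : R 0 0) (p : ℕ) :
    ∃ q, Good N (ext R p q) := by
  classical
  have hRN : Good N R := hR.mono (by omega)
  obtain ⟨a1, b1, r1, l1, m1⟩ : ∃ a1 b1, R a1 b1 ∧ a1 ≤ p ∧ ∀ a b, R a b → a ≤ p → a ≤ a1 := by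
    let P : ℕ → Prop := fun a => ∃ b, R a b
    have hs : P (Nat.findGreatest P p) := Nat.findGreatest_spec (P := P) (Nat.zero_le p) ⟨0, h0⟩
    obtain ⟨b, hb⟩ := hs
    exact ⟨_, b, hb, Nat.findGreatest_le p,
      fun a b' hab hap => Nat.le_findGreatest (P := P) hap ⟨b', hab⟩⟩
  by_cases c1 : p < a1 + N
  · refine ⟨b1 + (p - a1), good_ext hRN ?_⟩
    intro a b hab d hd
    have x1 := hR a b a1 b1 hab r1 (d - (p - a1)) (by omega)
    have x2 := hR a1 b1 a b r1 hab (d + (p - a1)) (by omega)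
    have x3 := hR a b a1 b1 hab r1 0 (by omega)
    have x4 := hR a1 b1 a b r1 hab (p - a1) (by omega)
    have x5 := hR a1 b1 a b r1 hab 0 (by omega)
    have x6 := m1 a b hab
    have x7 := hR a1 b1 a b r1 hab (p - a1 + 1) (by omega)
    constructor <;> omega
  by_cases h2 : ∃ a, p ≤ a ∧ ∃ b, R a b
  · obtain ⟨l2, b2, r2⟩ := Nat.find_spec h2
    have m2 : ∀ a b, R a b → p ≤ a → Nat.find h2 ≤ a :=
      fun a b hab hp => Nat.find_min' h2 ⟨hp, b, hab⟩
    generalize Nat.find h2 = a2 at l2 r2 m2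
    have y := hR a1 b1 a2 b2 r1 r2
    by_cases c2 : a2 < p + N
    · have y1 := y N (by omega)
      refine ⟨b2 - (a2 - p), good_ext hRN ?_⟩
      intro a b hab d hd
      have x1 := hR a2 b2 a b r2 hab (d - (a2 - p)) (by omega)
      have x2 := hR a b a2 b2 hab r2 (d + (a2 - p)) (by omega)
      have x3 := hR a2 b2 a b r2 hab 0 (by omega)
      have x4 := hR a b a2 b2 hab r2 (a2 - p) (by omega)
      have x5 := hR a b a2 b2 hab r2 0 (by omega)
      have x6 := m2 a b hab
      have x7 := hR a b a2 b2 hab r2 (a2 - p + 1) (by omega)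
      constructor <;> omega
    · have y1 := y (2 * N) (by omega)
      refine ⟨b1 + N, good_ext hRN ?_⟩
      intro a b hab d hd
      have x1 := hR a2 b2 a b r2 hab 0 (by omega)
      have x2 := hR a b a1 b1 hab r1 0 (by omega)
      have x3 := m2 a b hab
      have x4 := m1 a b hab
      constructor <;> omega
  · refine ⟨b1 + N, good_ext hRN ?_⟩
    intro a b hab d hd
    have x2 := hR a b a1 b1 hab r1 0 (by omega)
    have x4 := m1 a b hab
    have x3 : a < p := by
      by_contra hc
      exact h2 ⟨a, by omega, b, hab⟩
    constructor <;> omega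

def MatchFO (n m : ℕ) (R : ℕ → ℕ → Prop) (v w : Node) : Prop :=
  ∃ l l' s, R l l' ∧ Ok n l s ∧ v = nd n l s ∧ w = nd m l' s

def MatchSO (n m : ℕ) (R : ℕ → ℕ → Prop) (A B : Set Node) : Prop :=
  ∃ u u' v v' i, R u u' ∧ (∀ s, R (v s) (v' s)) ∧ A = SS n u v i ∧ B = SS m u' v' i

theorem Good.le {N R} (h : Good N R) {a b a' b'} (h1 : R a b) (h2 : R a' b') :
    a ≤ a' ↔ b ≤ b' := by simpa using h a b a' b' h1 h2 0 (by omega)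

theorem Good.lt {N R} (h : Good N R) {a b a' b'} (h1 : R a b) (h2 : R a' b') :
    a < a' ↔ b < b' := by have := h.le h2 h1; omega

theorem MatchFO.swap {N n m R v w} (hR : Good N R) (hn : R n m) (h : MatchFO n m R v w) :
    MatchFO m n (fun a b => R b a) w v := by
  obtain ⟨l, l', s, h1, h2, h3, h4⟩ := h
  exact ⟨l', l, s, h1, fun hs => (hR.lt hn h1).1 (h2 hs), h4, h3⟩

theorem MatchSO.swap {n m R v w} (h : MatchSO n m R v w) :
    MatchSO m n (fun a b => R b a) w v := by
  obtain ⟨u, u', v, v', i, h1, h2, h3, h4⟩ := h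
  exact ⟨u', u, v', v, i, h1, h2, h4, h3⟩

theorem MatchFO.mono {n m v w} {R R' : ℕ → ℕ → Prop} (hR : ∀ a b, R a b → R' a b)
    (h : MatchFO n m R v w) : MatchFO n m R' v w := by
  obtain ⟨l, l', s, h1, h2⟩ := h
  exact ⟨l, l', s, hR _ _ h1, h2⟩

theorem MatchSO.mono {n m v w} {R R' : ℕ → ℕ → Prop} (hR : ∀ a b, R a b → R' a b)
    (h : MatchSO n m R v w) : MatchSO n m R' v w := by
  obtain ⟨u, u', v, v', i, h1, h2, h3⟩ := h
  exact ⟨u, u', v, v', i, hR _ _ h1, fun s => hR _ _ (h2 s), h3⟩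

def rk {AP : Type} : MSOL AP → ℕ
  | .atom _ _ => 0
  | .le _ _ => 0
  | .mem _ _ => 0
  | .not φ => rk φ
  | .and φ ψ => max (rk φ) (rk ψ)
  | .exFO _ φ => rk φ + 1
  | .exSO _ φ => rk φ + 3

structure Sit {AP : Type} (φ : MSOL AP) (k n m : ℕ) (R : ℕ → ℕ → Prop) (V1 : ℕ → Node)
    (V2 : ℕ → Set Node) (W1 : ℕ → Node) (W2 : ℕ → Set Node) : Prop where
  good : Good (2 ^ k) R
  zero : R 0 0
  br : R n m
  fo : ∀ x ∈ φ.freeFO, MatchFO n m R (V1 x) (W1 x)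
  so : ∀ X ∈ φ.freeSO, MatchSO n m R (V2 X) (W2 X)

theorem Sit.swap {AP : Type} {φ : MSOL AP} {k n m R V1 V2 W1 W2}
    (h : Sit φ k n m R V1 V2 W1 W2) : Sit φ k m n (fun a b => R b a) W1 W2 V1 V2 :=
  ⟨h.good.swap, h.zero, h.br, fun x hx => (h.fo x hx).swap h.good h.br,
    fun X hX => (h.so X hX).swap⟩

def BFInv {AP : Type} (φ : MSOL AP) : Prop := ∀ n m R V1 V2 W1 W2,
  Sit φ (rk φ) n m R V1 V2 W1 W2 →
    (Sat MTLdom (KK AP n) V1 V2 φ ↔ Sat MTLdom (KK AP m) W1 W2 φ)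

theorem fo_step {AP : Type} {φ : MSOL AP} {x : ℕ} (ih : BFInv φ) {n m R V1 V2 W1 W2}
    (h : Sit (.exFO x φ) (rk (.exFO x φ)) n m R V1 V2 W1 W2)
    (hs : Sat MTLdom (KK AP n) V1 V2 (.exFO x φ)) : Sat MTLdom (KK AP m) W1 W2 (.exFO x φ) := by
  obtain ⟨τ, ⟨l, s, ok, rfl⟩, hs⟩ := hs
  have hg := h.good
  rw [rk, pow_succ, mul_comm] at hg
  obtain ⟨l', hl'⟩ := extend Nat.one_le_two_pow hg h.zero l
  have hm : MatchFO n m (ext R l l') (nd n l s) (nd m l' s) :=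
    ⟨l, l', s, Or.inr ⟨rfl, rfl⟩, ok, rfl, rfl⟩
  refine ⟨nd m l' s, ⟨l', s, fun hh => (hl'.lt (Or.inl h.br) (Or.inr ⟨rfl, rfl⟩)).1 (ok hh), rfl⟩,
    (ih n m (ext R l l') _ _ _ _ ⟨hl', Or.inl h.zero, Or.inl h.br, ?_, ?_⟩).1 hs⟩
  · intro y hy
    by_cases e : y = x
    · subst e; simpa using hm
    · simp only [Function.update_of_ne e]
      exact (h.fo y ⟨hy, e⟩).mono fun a b => Or.inl
  · intro X hX
    exact (h.so X hX).mono fun a b => Or.inl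

theorem so_step {AP : Type} {φ : MSOL AP} {x : ℕ} (ih : BFInv φ) {n m R V1 V2 W1 W2}
    (h : Sit (.exSO x φ) (rk (.exSO x φ)) n m R V1 V2 W1 W2)
    (hs : Sat MTLdom (KK AP n) V1 V2 (.exSO x φ)) : Sat MTLdom (KK AP m) W1 W2 (.exSO x φ) := by
  obtain ⟨S, hS, hs⟩ := hs
  obtain ⟨u, v, i, hv, rfl⟩ := dom_SS hS
  have hg := h.good
  rw [rk, pow_succ, mul_comm] at hg
  obtain ⟨u', g1⟩ := extend Nat.one_le_two_pow hg h.zero u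
  rw [pow_succ, mul_comm] at g1
  obtain ⟨v0, g2⟩ := extend Nat.one_le_two_pow g1 (Or.inl h.zero) (v false)
  rw [pow_succ, mul_comm] at g2
  obtain ⟨v1, g3⟩ := extend Nat.one_le_two_pow g2 (Or.inl (Or.inl h.zero)) (v true)
  generalize hR' : ext (ext (ext R u u') (v false) v0) (v true) v1 = R' at g3
  have hsub : ∀ a b, R a b → R' a b := by
    rintro a b hab; rw [← hR']; exact Or.inl (Or.inl (Or.inl hab))
  have ru : R' u u' := by rw [← hR']; exact Or.inl (Or.inl (Or.inr ⟨rfl, rfl⟩))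
  have r0 : R' (v false) v0 := by rw [← hR']; exact Or.inl (Or.inr ⟨rfl, rfl⟩)
  have r1 : R' (v true) v1 := by rw [← hR']; exact Or.inr ⟨rfl, rfl⟩
  have rn := hsub _ _ h.br
  have hm : MatchSO n m R' (SS n u v i) (SS m u' (fun s => cond s v1 v0) i) :=
    ⟨u, u', v, _, i, ru, fun s => by cases s <;> assumption, rfl, rfl⟩
  have hv' : Vd m u' (fun s => cond s v1 v0) i := by
    unfold Vd at hv ⊢
    rw [g3.le ru rn, g3.lt rn r0, g3.le r1 ru, g3.lt ru r0, g3.le r0 ru, g3.lt rn ru,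
      g3.lt ru r1] at hv
    exact hv
  refine ⟨_, SS_dom hv', (ih n m R' _ _ _ _ ⟨g3, hsub _ _ h.zero, rn, ?_, ?_⟩).1 hs⟩
  · intro X hX
    exact (h.fo X hX).mono hsub
  · intro y hy
    by_cases e : y = x
    · subst e; simpa using hm
    · simp only [Function.update_of_ne e]
      exact (h.so y ⟨hy, e⟩).mono hsub

theorem inv_all {AP : Type} (φ : MSOL AP) : BFInv φ := by
  induction φ with
  | atom a x => intro n m R V1 V2 W1 W2 h; simp [Sat, KK]
  | le x y =>
    intro n m R V1 V2 W1 W2 h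
    obtain ⟨l, l', s, a1, a2, a3, a4⟩ := h.fo x (by simp [MSOL.freeFO])
    obtain ⟨k, k', t, b1, b2, b3, b4⟩ := h.fo y (by simp [MSOL.freeFO])
    have a2' : Ok m l' s := fun e => (h.good.lt h.br a1).1 (a2 e)
    have b2' : Ok m k' t := fun e => (h.good.lt h.br b1).1 (b2 e)
    simp only [Sat, a3, a4, b3, b4, nd_prefix a2 b2, nd_prefix a2' b2', h.good.le a1 b1,
      h.good.le a1 h.br]
    have m1 : nd n l s ∈ (KK AP n).T := ⟨_, _, a2, rfl⟩
    have m2 : nd n k t ∈ (KK AP n).T := ⟨_, _, b2, rfl⟩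
    have m3 : nd m l' s ∈ (KK AP m).T := ⟨_, _, a2', rfl⟩
    have m4 : nd m k' t ∈ (KK AP m).T := ⟨_, _, b2', rfl⟩
    simp only [m1, m2, m3, m4]
  | mem x X =>
    intro n m R V1 V2 W1 W2 h
    obtain ⟨l, l', s, a1, a2, a3, a4⟩ := h.fo x (by simp [MSOL.freeFO])
    obtain ⟨u, u', v, v', i, b1, b2, b3, b4⟩ := h.so X (by simp [MSOL.freeSO])
    have a2' : Ok m l' s := fun e => (h.good.lt h.br a1).1 (a2 e)
    simp only [Sat, a3, a4, b3, b4, mem_SS a2, mem_SS a2', h.good.le b1 a1, h.good.lt a1 (b2 s)]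
  | not φ ih =>
    intro n m R V1 V2 W1 W2 h
    exact not_congr (ih n m R V1 V2 W1 W2 ⟨h.good, h.zero, h.br, h.fo, h.so⟩)
  | and φ ψ ih1 ih2 =>
    intro n m R V1 V2 W1 W2 h
    refine and_congr (ih1 n m R V1 V2 W1 W2 ⟨h.good.mono ?_, h.zero, h.br,
      fun x hx => h.fo x (Or.inl hx), fun x hx => h.so x (Or.inl hx)⟩)
      (ih2 n m R V1 V2 W1 W2 ⟨h.good.mono ?_, h.zero, h.br,
      fun x hx => h.fo x (Or.inr hx), fun x hx => h.so x (Or.inr hx)⟩)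
    · exact Nat.pow_le_pow_right (by norm_num) (le_max_left _ _)
    · exact Nat.pow_le_pow_right (by norm_num) (le_max_right _ _)
  | exFO x φ ih =>
    intro n m R V1 V2 W1 W2 h
    exact ⟨fo_step ih h, fo_step ih h.swap⟩
  | exSO x φ ih =>
    intro n m R V1 V2 W1 W2 h
    exact ⟨so_step ih h, so_step ih h.swap⟩

theorem mtl_blind {AP : Type} (φ : MSOL AP) (hφ : φ.IsSentence) (n : ℕ) (hn : 2 ^ rk φ ≤ n) :
    (MTL AP).KSat (KK AP n) φ ↔ (MTL AP).KSat (KK AP (n + 1)) φ := by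
  refine exists_congr fun V1 => exists_congr fun V2 => ?_
  refine inv_all φ n (n + 1) (fun a b => (a = 0 ∧ b = 0) ∨ (a = n ∧ b = n + 1)) V1 V2 V1 V2
    ⟨?_, by simp, by simp, by simp [hφ.1], by simp [hφ.2]⟩
  have : 0 < 2 ^ rk φ := by positivity
  rintro a b a' b' h h' d hd
  omega

/-! ### The MSO sentence -/

namespace MSOL

def childF {AP : Type} (x y z : ℕ) : MSOL AP :=
  and (le x y) (and (not (le y x)) (all' z (imp' (and (le x z) (le z y)) (or' (le z x) (le y z)))))

def evenF (AP : Type) : MSOL AP :=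
  exSO 0 (and (all' 0 (imp' (all' 1 (le 0 1)) (mem 0 0)))
    (and (all' 0 (all' 1 (imp' (childF 0 1 2)
      (and (imp' (mem 0 0) (not (mem 1 0))) (or' (mem 0 0) (mem 1 0))))))
    (exFO 0 (and (mem 0 0) (exFO 1 (exFO 2 (and (childF 0 1 3) (and (childF 0 2 3)
      (not (le 1 2))))))))))

theorem evenF_sentence (AP : Type) : (evenF AP).IsSentence := by
  constructor
  · simp only [evenF, childF, all', imp', or', freeFO]
    ext y; simp; omega
  · simp only [evenF, childF, all', imp', or', freeSO]
    ext y; simp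

end MSOL

theorem sat_child {AP : Type} (D : SODom) (n : ℕ) (V1 V2) (x y z : ℕ) (hxz : x ≠ z) (hyz : y ≠ z)
    (hx : V1 x ∈ TT n) (hy : V1 y ∈ TT n) :
    Sat D (KK AP n) V1 V2 (MSOL.childF x y z) ↔ 
      V1 x <+: V1 y ∧ (V1 y).length = (V1 x).length + 1 := by
  simp only [MSOL.childF, MSOL.all', MSOL.imp', MSOL.or', Sat, Function.update_self,
    Function.update_of_ne hxz, Function.update_of_ne hyz]
  have e : (KK AP n).T = TT n := rfl
  simp only [e, hx, hy, true_and]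
  constructor
  · rintro ⟨h1, h2, h3⟩
    refine ⟨h1, ?_⟩
    push Not at h3
    obtain ⟨t, ht⟩ := h1
    cases t with
    | nil => simp at ht; rw [ht] at h2; simp at h2
    | cons a t =>
      have hz : V1 x ++ [a] <+: V1 y := ⟨t, by simp [← ht]⟩
      have hzT := TT_prefix hy hz
      have := h3 _ hzT ⟨⟨hzT, List.prefix_append _ _⟩, hzT, hz⟩
      by_contra hc
      have hl := hz.length_le
      simp at hl
      have := this (fun _ h => by have := h.length_le; simp at this)
      have := this.2.length_le
      simp at this
      omega
  · rintro ⟨h1, h2⟩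
    refine ⟨h1, fun h => by have := h.length_le; omega, ?_⟩
    push Not
    rintro σ hσ ⟨⟨_, ha⟩, _, hb⟩ hc
    refine ⟨hσ, ?_⟩
    have l1 := ha.length_le
    have l2 := hb.length_le
    by_cases hl : σ.length = (V1 x).length
    · exact absurd (ha.eq_of_length hl.symm ▸ List.prefix_refl _) (hc hσ)
    · rw [hb.eq_of_length (by omega)]

theorem ksat_even (AP : Type) (n : ℕ) :
    (MSO AP).KSat (KK AP n) (MSOL.evenF AP) ↔ ∃ S ⊆ TT n, 
      (∀ x ∈ TT n, (∀ y ∈ TT n, x <+: y) → x ∈ S) ∧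
      (∀ x ∈ TT n, ∀ y ∈ TT n, x <+: y → y.length = x.length + 1 → (x ∈ S ↔ y ∉ S)) ∧
      (∃ x ∈ TT n, x ∈ S ∧ ∃ y ∈ TT n, ∃ z ∈ TT n, (x <+: y ∧ y.length = x.length + 1) ∧
        (x <+: z ∧ z.length = x.length + 1) ∧ ¬ y <+: z) := by
  have e : (KK AP n).T = TT n := rfl
  have key : ∀ V1 V2, Sat MSOdom (KK AP n) V1 V2 (MSOL.evenF AP) ↔ ∃ S ⊆ TT n, 
      (∀ x ∈ TT n, (∀ y ∈ TT n, x <+: y) → x ∈ S) ∧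
      (∀ x ∈ TT n, ∀ y ∈ TT n, x <+: y → y.length = x.length + 1 → (x ∈ S ↔ y ∉ S)) ∧
      (∃ x ∈ TT n, x ∈ S ∧ ∃ y ∈ TT n, ∃ z ∈ TT n, (x <+: y ∧ y.length = x.length + 1) ∧
        (x <+: z ∧ z.length = x.length + 1) ∧ ¬ y <+: z) := by
    intro V1 V2
    unfold MSOL.evenF
    simp only [MSOL.all', MSOL.imp', MSOL.or', Sat, e]
    refine exists_congr fun S => and_congr Iff.rfl (and_congr ?_ (and_congr ?_ ?_))
    · simp [Function.update]
      refine forall₂_congr fun x hx => ?_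
      refine imp_congr (forall₂_congr fun y hy => ?_) Iff.rfl
      simp [hx, hy]
    · push Not
      refine forall₂_congr fun x hx => forall₂_congr fun y hy => ?_
      rw [sat_child MSOdom n _ _ 0 1 2 (by simp) (by simp) (by simpa) (by simpa)]
      simp [Function.update]
      tauto
    · refine exists_congr fun x => and_congr_right fun hx => and_congr ?_ (exists_congr fun y =>
        and_congr_right fun hy => exists_congr fun z => and_congr_right fun hz => ?_)
      · simp
      · rw [sat_child MSOdom n _ _ 0 1 3 (by simp) (by simp) (by simpa) (by simpa),
          sat_child MSOdom n _ _ 0 2 3 (by simp) (by simp) (by simpa) (by simpa)]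
        simp [Function.update, hy, hz]
  constructor
  · rintro ⟨V1, V2, h⟩
    exact (key V1 V2).1 h
  · intro h
    exact ⟨fun _ => [], fun _ => ∅, (key _ _).2 h⟩

theorem mso_even (AP : Type) (n : ℕ) :
    (MSO AP).KSat (KK AP n) (MSOL.evenF AP) ↔ Even n := by
  rw [ksat_even]
  have okf : ∀ l, Ok n l false := fun l => by simp [Ok]
  constructor
  · rintro ⟨S, hS, h1, h2, x, hx, hxS, y, hy, z, hz, ⟨p1, l1⟩, ⟨p2, l2⟩, hne⟩
    have ind : ∀ k, (nd n k false ∈ S ↔ Even k) := by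
      intro k
      induction k with
      | zero =>
        simp only [Even.zero, iff_true]
        exact h1 _ (nil_mem n) (fun y _ => List.nil_prefix)
      | succ k ih =>
        have := h2 (nd n k false) ⟨k, false, okf k, rfl⟩ (nd n (k + 1) false)
          ⟨k + 1, false, okf _, rfl⟩ ((nd_prefix (okf _) (okf _)).2 ⟨by omega, Or.inl rfl⟩)
          (by rw [nd_length (okf _), nd_length (okf _)])
        rw [Nat.even_add_one, ← ih, this, not_not]
    obtain ⟨l, s, ok, rfl⟩ := hx
    obtain ⟨l', s', ok', rfl⟩ := hy
    obtain ⟨l'', s'', ok'', rfl⟩ := hz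
    rw [nd_length ok, nd_length ok'] at l1
    rw [nd_length ok, nd_length ok''] at l2
    rw [nd_prefix ok ok'] at p1
    rw [nd_prefix ok ok''] at p2
    rw [nd_prefix ok' ok''] at hne
    have : s = false ∧ l = n := by
      unfold Ok at *
      cases s <;> cases s' <;> cases s'' <;> simp at * <;> omega
    obtain ⟨rfl, rfl⟩ := this
    exact (ind l).1 hxS
  · intro he
    refine ⟨{τ | τ ∈ TT n ∧ Even τ.length}, fun τ h => h.1, ?_, ?_, ?_⟩
    · intro x hx h
      have := (h [] (nil_mem n))
      simp at this
      subst this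
      exact ⟨hx, by simp⟩
    · intro x hx y hy _ hl
      simp [hx, hy, hl, Nat.even_add_one]
    · have okt : Ok n (n + 1) true := fun _ => by omega
      refine ⟨nd n n false, ⟨_, _, okf _, rfl⟩, ⟨⟨_, _, okf _, rfl⟩, by rwa [nd_length (okf _)]⟩,
        nd n (n + 1) false, ⟨_, _, okf _, rfl⟩, nd n (n + 1) true, ⟨_, _, okt, rfl⟩, ?_⟩
      rw [nd_prefix (okf _) (okf _), nd_prefix (okf _) okt, nd_prefix (okf _) okt,
        nd_length (okf _), nd_length (okf _), nd_length okt]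
      simp

theorem part2 (AP : Type) : ¬ MLogic.Leq (finBrKT AP) (MSO AP) (MTL AP) := by
  intro h
  obtain ⟨φ, hφ, _, hK⟩ := h _ (MSOL.evenF_sentence AP) trivial
  have h1 := hK _ (KK_fin AP (2 ^ rk φ))
  have h2 := hK _ (KK_fin AP (2 ^ rk φ + 1))
  have h3 := mtl_blind φ hφ _ le_rfl
  rw [mso_even] at h1 h2
  rw [Nat.even_add_one] at h2
  tauto

/-- MTL < MSO, even over finitely-branching Kripke trees. -/
theorem stmt1 (AP : Type) [Fintype AP] :
    MLogic.Leq (finBrKT AP) (MTL AP) (MSO AP) ∧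
    ¬ MLogic.Leq (finBrKT AP) (MSO AP) (MTL AP) := by
  exact ⟨part1 AP, part2 AP⟩
end

section
/- The density property is not expressible in MPL, even over finitely-branching Kripke trees: there is no MPL sentence φ such that, for every finitely-branching Kripke tree (T, Lab), (T, Lab) satisfies φ if and only if T is dense. -/
namespace MPLDens

def rk (n : ℕ) (x : Node) : ℕ := min n (x.getLast?.getD n)

theorem rk_nil (n : ℕ) : rk n [] = n := by simp [rk]
theorem rk_snoc (n : ℕ) (x : Node) (a : ℕ) : rk n (x ++ [a]) = min n a := by simp [rk]
theorem rk_le (n : ℕ) (x : Node) : rk n x ≤ n := by simp [rk]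

def Tr (n M : ℕ) : Set Node :=
  {x | ∀ y a, y ++ [a] <+: x → a ≤ M ∧ min n a ≤ rk n y}

theorem nil_mem (n M : ℕ) : ([] : Node) ∈ Tr n M := by
  intro y a h
  simp at h

theorem Tr_prefix {n M : ℕ} {x y : Node} (hy : y ∈ Tr n M) (h : x <+: y) : x ∈ Tr n M :=
  fun z a hz => hy z a (hz.trans h)

theorem snoc_mem {n M : ℕ} {x : Node} {a : ℕ} :
    x ++ [a] ∈ Tr n M ↔ x ∈ Tr n M ∧ a ≤ M ∧ min n a ≤ rk n x := by
  constructor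
  · intro h
    exact ⟨Tr_prefix h (List.prefix_append _ _), h x a (List.prefix_refl _)⟩
  · rintro ⟨hx, ha⟩ y b hy
    rcases List.prefix_concat_iff.1 hy with h | h
    · obtain ⟨rfl, h2⟩ := List.append_inj' h rfl
      simp at h2
      subst h2
      exact ha
    · exact hx y b h

theorem rk_mono {n M : ℕ} {x y : Node} (hy : y ∈ Tr n M) (h : x <+: y) : rk n y ≤ rk n x := by
  obtain ⟨z, rfl⟩ := h
  induction z using List.reverseRecOn with
  | nil => simp
  | append_singleton z a ih =>
    rw [← List.append_assoc] at hy ⊢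
    have := snoc_mem.1 hy
    rw [rk_snoc]
    exact this.2.2.trans (ih this.1)

theorem Tr_rooted (n M : ℕ) : IsTreeRooted (Tr n M) [] :=
  ⟨nil_mem n M, fun τ _ => List.nil_prefix, fun σ σ' h h' => Tr_prefix (by simpa using h) (by simpa using h')⟩

theorem Tr_nb {n M : ℕ} (h : n ≤ M) : NonBlocking (Tr n M) := by
  intro τ hτ
  refine ⟨rk n τ, snoc_mem.2 ⟨hτ, (rk_le _ _).trans h, min_le_right _ _⟩⟩

theorem Tr_fin (n M : ℕ) : FinBranching (Tr n M) := by
  intro τ hτ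
  apply ((Set.finite_Iic M).image (fun a => τ ++ [a])).subset
  rintro _ ⟨h, a, rfl⟩
  exact ⟨a, (snoc_mem.1 h).2.1, rfl⟩

def KT (AP : Type) (n M : ℕ) (h : n ≤ M) : KripkeTree AP :=
  ⟨Tr n M, [], Tr_rooted n M, Tr_nb h, fun _ => ∅⟩

theorem not_dense (n : ℕ) : ¬ DenseTree (Tr n n) := by
  rintro ⟨S, ⟨hST, r, hr, -⟩, hS⟩
  have key : ∀ k, ∀ τ ∈ S, rk n τ ≤ k → False := by
    intro k
    induction k using Nat.strong_induction_on with
    | _ k ih =>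
    intro τ hτ hk
    obtain ⟨τ', hτ', hp, a, b, hab, ha, hb⟩ := hS τ hτ
    have h1 := rk_mono (hST hτ') hp
    have h2 := (snoc_mem.1 (hST ha)).2
    have h3 := (snoc_mem.1 (hST hb)).2
    have h4 := rk_snoc n τ' a
    have h5 := rk_snoc n τ' b
    rcases Nat.lt_or_gt_of_ne hab with h | h
    · exact ih (rk n (τ' ++ [a])) (by omega) _ ha le_rfl
    · exact ih (rk n (τ' ++ [b])) (by omega) _ hb le_rfl
  exact key _ r hr le_rfl

theorem dense (n : ℕ) : DenseTree (Tr n (n+1)) := by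
  have hrk : ∀ x : Node, (∀ a ∈ x, a = n ∨ a = n + 1) → rk n x = n := by
    intro x hx
    rcases List.eq_nil_or_concat x with rfl | ⟨y, a, rfl⟩
    · exact rk_nil n
    · rw [List.concat_eq_append] at *
      rw [rk_snoc]
      have := hx a (by simp)
      omega
  refine ⟨{x | ∀ a ∈ x, a = n ∨ a = n + 1}, ⟨?_, [], ?_, ?_, ?_⟩, ?_⟩
  · intro x hx y a h
    have h1 : a = n ∨ a = n + 1 := hx a (h.subset (by simp))
    have h2 := hrk y (fun b hb => hx b (h.subset (by simp [hb])))
    omega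
  · simp
  · intro τ _; exact List.nil_prefix
  · intro σ σ' h h' a ha
    exact h a (by simpa using h'.subset (by simpa using ha))
  · intro τ hτ
    refine ⟨τ, hτ, List.prefix_refl _, n, n+1, by omega, ?_, ?_⟩
    · intro a ha
      simp at ha
      rcases ha with ha | ha
      · exact hτ a ha
      · exact Or.inl ha
    · intro a ha
      simp at ha
      rcases ha with ha | ha
      · exact hτ a ha
      · exact Or.inr ha

/-- Back-and-forth state. -/
structure St (n M M' K k : ℕ) (R : Node → Node → Prop) : Prop where
  nil : R [] []
  memL : ∀ x y, R x y → x ∈ Tr n M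
  memR : ∀ x y, R x y → y ∈ Tr n M'
  fn : ∀ x y y', R x y → R x y' → y = y'
  inj : ∀ x x' y, R x y → R x' y → x = x'
  parL : ∀ x a z, R (x ++ [a]) z → ∃ y b, z = y ++ [b] ∧ R x y
  parR : ∀ y b z, R z (y ++ [b]) → ∃ x a, z = x ++ [a] ∧ R x y
  rank : ∀ x y, R x y → min (rk n x) (k * (K+1)) = min (rk n y) (k * (K+1))
  br : ∀ x, ∃ s : Finset ℕ, s.card + k ≤ K ∧ ∀ a z, R (x ++ [a]) z → a ∈ s

theorem St.br' {n M M' K k : ℕ} {R} (h : St n M M' K k R) (y : Node) :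
    ∃ s : Finset ℕ, s.card + k ≤ K ∧ ∀ b z, R z (y ++ [b]) → b ∈ s := by
  classical
  by_cases hy : ∃ x, R x y
  · obtain ⟨x, hx⟩ := hy
    obtain ⟨s, hs, hs'⟩ := h.br x
    let f : ℕ → ℕ := fun a => if ha : ∃ b, R (x ++ [a]) (y ++ [b]) then ha.choose else 0
    refine ⟨s.image f, by have := Finset.card_image_le (s := s) (f := f); omega, ?_⟩
    intro b z hz
    obtain ⟨x', a, rfl, hx'⟩ := h.parR _ _ _ hz
    obtain rfl := h.inj _ _ _ hx hx'
    refine Finset.mem_image.2 ⟨a, hs' _ _ hz, ?_⟩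
    have ha : ∃ b, R (x ++ [a]) (y ++ [b]) := ⟨b, hz⟩
    have h1 : f a = ha.choose := dif_pos ha
    have h2 := h.fn _ _ _ ha.choose_spec hz
    rw [h1]
    simpa using h2
  · obtain ⟨s, hs, -⟩ := h.br []
    refine ⟨∅, by simp; omega, ?_⟩
    intro b z hz
    obtain ⟨x', a, rfl, hx'⟩ := h.parR _ _ _ hz
    exact absurd ⟨_, hx'⟩ hy

theorem St.symm {n M M' K k : ℕ} {R} (h : St n M M' K k R) : St n M' M K k (fun x y => R y x) where
  nil := h.nil
  memL := fun x y hh => h.memR _ _ hh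
  memR := fun x y hh => h.memL _ _ hh
  fn := fun x y y' h1 h2 => h.inj _ _ _ h1 h2
  inj := fun x y y' h1 h2 => h.fn _ _ _ h1 h2
  parL := h.parR
  parR := h.parL
  rank := fun x y hh => (h.rank _ _ hh).symm
  br := h.br'

inductive Ext (C : Set Node) (R : Node → Node → Prop) (sel : Node → Node → ℕ → ℕ) :
    Node → Node → Prop
  | old {x y} : R x y → Ext C R sel x y
  | new {x y a} : Ext C R sel x y → x ++ [a] ∈ C → (∀ z, ¬ R (x ++ [a]) z) →
      Ext C R sel (x ++ [a]) (y ++ [sel x y a])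

def Good (n M' t : ℕ) (R : Node → Node → Prop) (y : Node) (a b : ℕ) : Prop :=
  y ++ [b] ∈ Tr n M' ∧ (∀ z, ¬ R z (y ++ [b])) ∧ min (min n b) t = min (min n a) t

theorem St.exists_old {n M M' K k : ℕ} {R} (h : St n M M' K (k+1) R) (hM' : n ≤ M')
    (hn : (k+1) * (K+1) ≤ n) {x y : Node} {a : ℕ} (hxy : R x y) (ha : x ++ [a] ∈ Tr n M)
    (hno : ∀ z, ¬ R (x ++ [a]) z) : ∃ b, Good n M' (k * (K+1)) R y a b := by
  have hT : (k+1) * (K+1) = k * (K+1) + K + 1 := by ring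
  have hr := h.rank _ _ hxy
  rw [hT] at hr hn
  have hy := h.memR _ _ hxy
  have ha' := (snoc_mem.1 ha).2
  set t := k * (K+1) with ht
  by_cases hlt : min n a < t + K + 1
  · refine ⟨a, snoc_mem.2 ⟨hy, by omega, by omega⟩, ?_, rfl⟩
    intro z hz
    obtain ⟨x', a', rfl, hx'⟩ := h.parR _ _ _ hz
    obtain rfl := h.inj _ _ _ hxy hx'
    have h2 := h.rank _ _ hz
    rw [rk_snoc, rk_snoc, hT] at h2
    have : a' = a := by omega
    subst this
    exact hno _ hz
  · obtain ⟨s, hs, hs'⟩ := h.br' y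
    obtain ⟨b, hb, hbs⟩ : ∃ b ∈ Finset.Icc t (t + K), b ∉ s := by
      apply Finset.exists_mem_notMem_of_card_lt_card
      simp
      omega
    rw [Finset.mem_Icc] at hb
    refine ⟨b, snoc_mem.2 ⟨hy, by omega, by omega⟩, fun z hz => hbs (hs' _ _ hz), by omega⟩

theorem St.ext {n M M' K k : ℕ} {R} (h : St n M M' K (k+1) R) (hM' : n ≤ M')
    (hn : (k+1) * (K+1) ≤ n) (C : Set Node) (hC : C ⊆ Tr n M)
    (hCp : ∀ x a, x ++ [a] ∈ C → x ∈ C) (hCu : ∀ x a b, x ++ [a] ∈ C → x ++ [b] ∈ C → a = b) :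
    ∃ R', St n M M' K k R' ∧ (∀ x y, R x y → R' x y) ∧ ∀ x ∈ C, ∃ y, R' x y := by
  classical
  set t := k * (K+1) with ht
  let sel : Node → Node → ℕ → ℕ := fun x y a =>
    if hg : ∃ b, Good n M' t R y a b then hg.choose else 0
  have hT : (k+1) * (K+1) = t + K + 1 := by rw [ht]; ring
  have hsel : ∀ x y a, (∃ b, Good n M' t R y a b) → Good n M' t R y a (sel x y a) := by
    intro x y a hg
    have : sel x y a = hg.choose := dif_pos hg
    rw [this]
    exact hg.choose_spec
  -- basic invariant
  have inv : ∀ x y, Ext C R sel x y → x ∈ Tr n M ∧ y ∈ Tr n M' ∧ min (rk n x) t = min (rk n y) t ∧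
      (R x y ∨ ((∀ z, ¬ R x z) ∧ (∀ z, ¬ R z y))) := by
    intro x y hxy
    induction hxy with
    | old h1 =>
      refine ⟨h.memL _ _ h1, h.memR _ _ h1, ?_, Or.inl h1⟩
      have := h.rank _ _ h1
      rw [hT] at this
      omega
    | @new x y a h1 h2 h3 ih =>
      obtain ⟨i1, i2, i3, i4⟩ := ih
      have hxa := hC h2
      have g : ∃ b, Good n M' t R y a b := by
        rcases i4 with i4 | ⟨i4, i5⟩
        · exact h.exists_old hM' hn i4 hxa h3
        · have hxa' := (snoc_mem.1 hxa).2
          have := rk_le n y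
          refine ⟨min (min n a) (rk n y), snoc_mem.2 ⟨i2, by omega, by omega⟩, ?_, by omega⟩
          intro z hz
          obtain ⟨x', a', rfl, hx'⟩ := h.parR _ _ _ hz
          exact i5 _ hx'
      obtain ⟨g1, g2, g3⟩ := hsel x y a g
      refine ⟨hxa, g1, ?_, Or.inr ⟨h3, g2⟩⟩
      rw [rk_snoc, rk_snoc, g3]
  have newR : ∀ x y a, Ext C R sel x y → x ++ [a] ∈ C → (∀ z, ¬ R (x ++ [a]) z) →
      ∀ z, ¬ R z (y ++ [sel x y a]) := by
    intro x y a h1 h2 h3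
    rcases (inv _ _ (Ext.new h1 h2 h3)).2.2.2 with h | h
    · exact absurd h (h3 _)
    · exact h.2
  have snoc_inj : ∀ {x y : Node} {a b : ℕ}, x ++ [a] = y ++ [b] → x = y ∧ a = b := by
    intro x y a b hh
    obtain ⟨h1, h2⟩ := List.append_inj' hh rfl
    exact ⟨h1, by simpa using h2⟩
  refine ⟨Ext C R sel, ?_, fun x y => Ext.old, ?_⟩
  · refine ⟨Ext.old h.nil, fun x y hh => (inv x y hh).1, fun x y hh => (inv x y hh).2.1,
      ?_, ?_, ?_, ?_, fun x y hh => (inv x y hh).2.2.1, ?_⟩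
    · intro x y y' h1
      induction h1 generalizing y' with
      | old h1 =>
        intro h2
        cases h2 with
        | old h2 => exact h.fn _ _ _ h1 h2
        | new a b c => exact absurd h1 (c _)
      | @new x y a e1 e2 e3 ih =>
        intro h2
        generalize hw : x ++ [a] = w at h2
        cases h2 with
        | old h2 => subst hw; exact absurd h2 (e3 _)
        | new a b c =>
          obtain ⟨rfl, rfl⟩ := snoc_inj hw
          obtain rfl := ih _ a
          rfl
    · intro x x' y h1
      induction h1 generalizing x' with
      | old h1 =>
        intro h2
        cases h2 with
        | old h2 => exact h.inj _ _ _ h1 h2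
        | new a b c => exact absurd h1 (newR _ _ _ a b c _)
      | @new x y a e1 e2 e3 ih =>
        intro h2
        generalize hw : y ++ [sel x y a] = w at h2
        cases h2 with
        | old h2 => subst hw; exact absurd h2 (newR _ _ _ e1 e2 e3 _)
        | new a b c =>
          obtain ⟨rfl, -⟩ := snoc_inj hw
          obtain rfl := ih _ a
          obtain rfl := hCu _ _ _ e2 b
          rfl
    · intro x a z hz
      generalize hw : x ++ [a] = w at hz
      cases hz with
      | old h2 =>
        subst hw
        obtain ⟨y, b, h1, h2⟩ := h.parL _ _ _ h2
        exact ⟨y, b, h1, Ext.old h2⟩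
      | new a b c =>
        obtain ⟨rfl, rfl⟩ := snoc_inj hw
        exact ⟨_, _, rfl, a⟩
    · intro y b z hz
      generalize hw : y ++ [b] = w at hz
      cases hz with
      | old h2 =>
        subst hw
        obtain ⟨y, b, h1, h2⟩ := h.parR _ _ _ h2
        exact ⟨y, b, h1, Ext.old h2⟩
      | new a b c =>
        obtain ⟨rfl, rfl⟩ := snoc_inj hw
        exact ⟨_, _, rfl, a⟩
    · intro x
      obtain ⟨s, hs, hs'⟩ := h.br x
      have hdom : ∀ a z, Ext C R sel (x ++ [a]) z → a ∈ s ∨ x ++ [a] ∈ C := by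
        intro a z hz
        generalize hw : x ++ [a] = w at hz
        cases hz with
        | old h2 => subst hw; exact Or.inl (hs' _ _ h2)
        | new a b c => exact Or.inr b
      by_cases hc : ∃ a, x ++ [a] ∈ C
      · obtain ⟨a, ha⟩ := hc
        refine ⟨insert a s, by have := Finset.card_insert_le a s; omega, ?_⟩
        intro b z hz
        rcases hdom b z hz with hh | hh
        · exact Finset.mem_insert_of_mem hh
        · rw [hCu _ _ _ hh ha]; exact Finset.mem_insert_self _ _
      · refine ⟨s, by omega, ?_⟩
        intro b z hz
        rcases hdom b z hz with hh | hh
        · exact hh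
        · exact absurd ⟨_, hh⟩ hc
  · intro x
    induction x using List.reverseRecOn with
    | nil => intro _; exact ⟨[], Ext.old h.nil⟩
    | append_singleton x a ih =>
      intro hx
      obtain ⟨y, hy⟩ := ih (hCp _ _ hx)
      by_cases hz : ∃ z, R (x ++ [a]) z
      · obtain ⟨z, hz⟩ := hz
        exact ⟨z, Ext.old hz⟩
      · exact ⟨_, Ext.new hy hx (fun z h => hz ⟨z, h⟩)⟩

theorem St.down {n M M' K k : ℕ} {R} (h : St n M M' K k R) {x x' y' : Node} (hR : R x' y')
    (hp : x <+: x') : ∃ y, y <+: y' ∧ R x y := by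
  obtain ⟨z, rfl⟩ := hp
  induction z using List.reverseRecOn generalizing y' with
  | nil => exact ⟨y', List.prefix_refl _, by simpa using hR⟩
  | append_singleton z a ih =>
    rw [← List.append_assoc] at hR
    obtain ⟨y, b, rfl, h2⟩ := h.parL _ _ _ hR
    obtain ⟨w, h3, h4⟩ := ih h2
    exact ⟨w, h3.trans (List.prefix_append _ _), h4⟩

theorem St.le {n M M' K k : ℕ} {R} (h : St n M M' K k R) {x y x' y' : Node} (h1 : R x y)
    (h2 : R x' y') (hp : x <+: x') : y <+: y' := by
  obtain ⟨z, hz, h3⟩ := h.down h2 hp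
  rwa [h.fn _ _ _ h1 h3]

def Mt (R : Node → Node → Prop) (P Q : Set Node) : Prop :=
  (∀ x ∈ P, ∃ y ∈ Q, R x y) ∧ ∀ y ∈ Q, ∃ x ∈ P, R x y

theorem Mt.symm {R} {P Q : Set Node} (h : Mt R P Q) : Mt (fun x y => R y x) Q P := ⟨h.2, h.1⟩

theorem Mt.mono {R R' : Node → Node → Prop} {P Q : Set Node} (h : Mt R P Q)
    (hR : ∀ x y, R x y → R' x y) : Mt R' P Q :=
  ⟨fun x hx => let ⟨y, h1, h2⟩ := h.1 x hx; ⟨y, h1, hR _ _ h2⟩,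
   fun x hx => let ⟨y, h1, h2⟩ := h.2 x hx; ⟨y, h1, hR _ _ h2⟩⟩

theorem St.extFO {n M M' K k : ℕ} {R} (h : St n M M' K (k+1) R) (hM' : n ≤ M')
    (hn : (k+1) * (K+1) ≤ n) {τ : Node} (hτ : τ ∈ Tr n M) :
    ∃ R' τ', St n M M' K k R' ∧ (∀ x y, R x y → R' x y) ∧ τ' ∈ Tr n M' ∧ R' τ τ' := by
  obtain ⟨R', h1, h2, h3⟩ := h.ext hM' hn {x | x <+: τ} (fun x hx => Tr_prefix hτ hx)
    (fun x a hx => (List.prefix_append x [a]).trans hx)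
    (fun x a b ha hb => by
      have := List.prefix_of_prefix_length_le ha hb (by simp)
      simpa using this.eq_of_length (by simp))
  obtain ⟨τ', h4⟩ := h3 τ (List.prefix_refl _)
  exact ⟨R', τ', h1, h2, h1.memR _ _ h4, h4⟩

theorem St.extSO {n M M' K k : ℕ} {R} (h : St n M M' K (k+1) R) (hM' : n ≤ M')
    (hn : (k+1) * (K+1) ≤ n) {P : Set Node} (hP : IsPathOf (Tr n M) P) :
    ∃ R' Q, St n M M' K k R' ∧ (∀ x y, R x y → R' x y) ∧ IsPathOf (Tr n M') Q ∧ Mt R' P Q := by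
  obtain ⟨⟨hPT, r, hr, hrp, hrc⟩, hPu⟩ := hP
  have hcl : ∀ x p, p ∈ P → x <+: p → r <+: x → x ∈ P := by
    rintro x p hp hx ⟨z, rfl⟩
    obtain ⟨w, rfl⟩ := hrp p hp
    exact hrc _ _ hp ((List.prefix_append_right_inj _).1 hx)
  obtain ⟨R', h1, h2, h3⟩ := h.ext hM' hn {x | ∃ p ∈ P, x <+: p}
    (fun x ⟨p, hp, hx⟩ => Tr_prefix (hPT hp) hx)
    (fun x a ⟨p, hp, hx⟩ => ⟨p, hp, (List.prefix_append x [a]).trans hx⟩)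
    (by
      rintro x a b ⟨p, hp, ha⟩ ⟨q, hq, hb⟩
      have hx : x <+: p := (List.prefix_append x [a]).trans ha
      by_cases hl : r.length ≤ x.length
      · have hrx := List.prefix_of_prefix_length_le (hrp p hp) hx hl
        exact hPu x (hcl _ _ hp hx hrx) a b
          (hcl _ _ hp ha (hrx.trans (List.prefix_append _ _)))
          (hcl _ _ hq hb (hrx.trans (List.prefix_append _ _)))
      · have e1 := List.prefix_of_prefix_length_le ha (hrp p hp) (by simp; omega)
        have e2 := List.prefix_of_prefix_length_le hb (hrp q hq) (by simp; omega)
        have := List.prefix_of_prefix_length_le e1 e2 (by simp)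
        simpa using this.eq_of_length (by simp))
  have hdom : ∀ x ∈ P, ∃ y, R' x y := fun x hx => h3 x ⟨x, hx, List.prefix_refl _⟩
  refine ⟨R', {y | ∃ x ∈ P, R' x y}, h1, h2, ⟨⟨?_, ?_⟩, ?_⟩, ?_, ?_⟩
  · rintro y ⟨x, _, hy⟩
    exact h1.memR _ _ hy
  · obtain ⟨r', hr'⟩ := hdom r hr
    refine ⟨r', ⟨r, hr, hr'⟩, ?_, ?_⟩
    · rintro y ⟨x, hx, hy⟩
      exact h1.le hr' hy (hrp x hx)
    · rintro σ σ' ⟨x, hx, hy⟩ hσ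
      obtain ⟨z, hz, hz'⟩ := h1.symm.down hy ((List.prefix_append_right_inj r').2 hσ)
      exact ⟨z, hcl _ _ hx hz (h1.symm.le hr' hz' (List.prefix_append _ _)), hz'⟩
  · rintro y ⟨x, hx, hxy⟩ a b ⟨x1, hx1, ha⟩ ⟨x2, hx2, hb⟩
    obtain ⟨w1, c1, rfl, hw1⟩ := h1.parR _ _ _ ha
    obtain ⟨w2, c2, rfl, hw2⟩ := h1.parR _ _ _ hb
    obtain rfl := h1.inj _ _ _ hxy hw1
    obtain rfl := h1.inj _ _ _ hxy hw2
    obtain rfl := hPu _ hx _ _ hx1 hx2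
    simpa using h1.fn _ _ _ ha hb
  · intro x hx
    obtain ⟨y, hy⟩ := hdom x hx
    exact ⟨y, ⟨x, hx, hy⟩, hy⟩
  · intro y hy; exact hy

def qd {AP : Type} : MSOL AP → ℕ
  | .atom _ _ => 0
  | .le _ _ => 0
  | .mem _ _ => 0
  | .not φ => qd φ
  | .and φ ψ => max (qd φ) (qd ψ)
  | .exFO _ φ => qd φ + 1
  | .exSO _ φ => qd φ + 1

theorem main {AP : Type} {n K : ℕ} (φ : MSOL AP) :
    ∀ (M M' k : ℕ) (hM : n ≤ M) (hM' : n ≤ M') (R : Node → Node → Prop) (V1 W1 : ℕ → Node)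
    (V2 W2 : ℕ → Set Node), qd φ ≤ k → k * (K+1) ≤ n → St n M M' K k R →
    (∀ x ∈ φ.freeFO, R (V1 x) (W1 x)) → (∀ X ∈ φ.freeSO, Mt R (V2 X) (W2 X)) →
    Sat MPLdom (KT AP n M hM) V1 V2 φ → Sat MPLdom (KT AP n M' hM') W1 W2 φ := by
  induction φ with
  | atom a x =>
    intro M M' k hM hM' R V1 W1 V2 W2 hq hn h h1 h2 hs
    exact absurd hs.2 (by simp [KT])
  | le x y =>
    intro M M' k hM hM' R V1 W1 V2 W2 hq hn h h1 h2 hs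
    have hx := h1 x (by simp [MSOL.freeFO])
    have hy := h1 y (by simp [MSOL.freeFO])
    exact ⟨h.memR _ _ hx, h.memR _ _ hy, h.le hx hy hs.2.2⟩
  | mem x X =>
    intro M M' k hM hM' R V1 W1 V2 W2 hq hn h h1 h2 hs
    have hx := h1 x (by simp [MSOL.freeFO])
    obtain ⟨y, hy, hxy⟩ := (h2 X (by simp [MSOL.freeSO])).1 _ hs
    obtain rfl := h.fn _ _ _ hxy hx
    exact hy
  | not φ ih =>
    intro M M' k hM hM' R V1 W1 V2 W2 hq hn h h1 h2 hs hs'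
    exact hs (ih M' M k hM' hM _ W1 V1 W2 V2 hq hn h.symm h1 (fun X hX => (h2 X hX).symm) hs')
  | and φ ψ ih1 ih2 =>
    intro M M' k hM hM' R V1 W1 V2 W2 hq hn h h1 h2 hs
    simp only [qd, max_le_iff] at hq
    exact ⟨ih1 M M' k hM hM' R V1 W1 V2 W2 hq.1 hn h (fun x hx => h1 x (Or.inl hx))
        (fun x hx => h2 x (Or.inl hx)) hs.1,
      ih2 M M' k hM hM' R V1 W1 V2 W2 hq.2 hn h (fun x hx => h1 x (Or.inr hx))
        (fun x hx => h2 x (Or.inr hx)) hs.2⟩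
  | exFO x φ ih =>
    intro M M' k hM hM' R V1 W1 V2 W2 hq hn h h1 h2 hs
    obtain ⟨τ, hτ, hs⟩ := hs
    simp only [qd] at hq
    obtain ⟨k, rfl⟩ : ∃ j, k = j + 1 := ⟨k - 1, by omega⟩
    obtain ⟨R', τ', g1, g2, g3, g4⟩ := h.extFO hM' hn hτ
    refine ⟨τ', g3, ih M M' k hM hM' R' _ _ V2 W2 (by omega)
      (le_trans (Nat.mul_le_mul_right _ (by omega)) hn) g1 ?_ ?_ hs⟩
    · intro y hy
      by_cases hyx : y = x
      · subst hyx; simpa using g4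
      · simp only [Function.update_of_ne hyx]
        exact g2 _ _ (h1 y ⟨hy, hyx⟩)
    · intro X hX
      exact (h2 X hX).mono g2
  | exSO x φ ih =>
    intro M M' k hM hM' R V1 W1 V2 W2 hq hn h h1 h2 hs
    obtain ⟨τ, hτ, hs⟩ := hs
    simp only [qd] at hq
    obtain ⟨k, rfl⟩ : ∃ j, k = j + 1 := ⟨k - 1, by omega⟩
    obtain ⟨R', τ', g1, g2, g3, g4⟩ := h.extSO hM' hn hτ
    refine ⟨τ', g3, ih M M' k hM hM' R' V1 W1 _ _ (by omega)
      (le_trans (Nat.mul_le_mul_right _ (by omega)) hn) g1 ?_ ?_ hs⟩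
    · intro y hy
      exact g2 _ _ (h1 y hy)
    · intro y hy
      by_cases hyx : y = x
      · subst hyx; simpa using g4
      · simp only [Function.update_of_ne hyx]
        exact (h2 y ⟨hy, hyx⟩).mono g2

theorem st_init (n M M' K : ℕ) : St n M M' K K (fun x y => x = [] ∧ y = []) where
  nil := ⟨rfl, rfl⟩
  memL := by rintro _ _ ⟨rfl, rfl⟩; exact nil_mem _ _
  memR := by rintro _ _ ⟨rfl, rfl⟩; exact nil_mem _ _
  fn := by rintro _ _ _ ⟨rfl, rfl⟩ ⟨_, rfl⟩; rfl
  inj := by rintro _ _ _ ⟨rfl, rfl⟩ ⟨rfl, _⟩; rfl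
  parL := by rintro x a z ⟨h, _⟩; simp at h
  parR := by rintro x a z ⟨_, h⟩; simp at h
  rank := by rintro _ _ ⟨rfl, rfl⟩; rfl
  br := fun x => ⟨∅, by simp, by rintro a z ⟨h, _⟩; simp at h⟩

end MPLDens

theorem stmt3 (AP : Type) [Fintype AP] :
    ¬ ∃ φ : MSOL AP, φ.IsSentence ∧
      ∀ K : KripkeTree AP, FinBranching K.T →
        ((MPL AP).KSat K φ ↔ DenseTree K.T) := by
  rintro ⟨φ, ⟨hf1, hf2⟩, hφ⟩
  let K := MPLDens.qd φ
  let n := K * (K + 1)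
  have hB := (hφ (MPLDens.KT AP n (n+1) (Nat.le_succ n)) (MPLDens.Tr_fin _ _)).2
    (MPLDens.dense n)
  obtain ⟨V1, V2, hs⟩ := hB
  refine MPLDens.not_dense n ((hφ (MPLDens.KT AP n n le_rfl) (MPLDens.Tr_fin _ _)).1
    ⟨V1, V2, MPLDens.main (K := K) φ (n+1) n K _ _ _ V1 V1 V2 V2 le_rfl le_rfl
      (MPLDens.st_init n (n+1) n K) ?_ ?_ hs⟩)
  · simp [hf1]
  · simp [hf2]
end

section
/- WMTL is strictly less expressive than WMSO, even over the class of finitely-branching Kripke trees: WMTL ≤ WMSO, and there is a WMSO sentence that has no equivalent WMTL sentence over finitely-branching Kripke trees. -/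
namespace Aux

variable {AP : Type}

lemma rooted_iff (S : Set Node) (r : Node) :
    IsTreeRooted S r ↔ r ∈ S ∧ ∀ y ∈ S, r <+: y ∧ ∀ z, r <+: z → z <+: y → z ∈ S := by
  constructor
  · rintro ⟨h1, h2, h3⟩
    refine ⟨h1, fun y hy => ⟨h2 y hy, ?_⟩⟩
    rintro z ⟨σ', rfl⟩ hz
    obtain ⟨σ, rfl⟩ := h2 y hy
    exact h3 σ σ' hy ((List.prefix_append_right_inj r).1 hz)
  · rintro ⟨h1, h2⟩
    refine ⟨h1, fun y hy => (h2 y hy).1, fun σ σ' h h' => ?_⟩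
    exact (h2 _ h).2 _ (List.prefix_append _ _) ((List.prefix_append_right_inj r).2 h')

def all (x : ℕ) (φ : MSOL AP) : MSOL AP := .not (.exFO x (.not φ))
def imp (φ ψ : MSOL AP) : MSOL AP := .not (.and φ (.not ψ))

lemma sat_all (D : SODom) (K : KripkeTree AP) (V1 V2 x) (φ : MSOL AP) :
    Sat D K V1 V2 (all x φ) ↔ ∀ τ ∈ K.T, Sat D K (Function.update V1 x τ) V2 φ := by
  simp [all, Sat]

lemma sat_imp (D : SODom) (K : KripkeTree AP) (V1 V2) (φ ψ : MSOL AP) :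
    Sat D K V1 V2 (imp φ ψ) ↔ (Sat D K V1 V2 φ → Sat D K V1 V2 ψ) := by
  simp [imp, Sat]

lemma freeFO_all (x : ℕ) (φ : MSOL AP) : (all x φ).freeFO = φ.freeFO \ {x} := rfl
lemma freeSO_all (x : ℕ) (φ : MSOL AP) : (all x φ).freeSO = φ.freeSO := rfl
lemma freeFO_imp (φ ψ : MSOL AP) : (imp φ ψ).freeFO = φ.freeFO ∪ ψ.freeFO := rfl
lemma freeSO_imp (φ ψ : MSOL AP) : (imp φ ψ).freeSO = φ.freeSO ∪ ψ.freeSO := rfl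

/-- formula saying that X is a tree -/
def treeF (X : ℕ) : MSOL AP :=
  .exFO 0 (.and (.mem 0 X) (all 1 (imp (.mem 1 X)
    (.and (.le 0 1) (all 2 (imp (.le 0 2) (imp (.le 2 1) (.mem 2 X))))))))

lemma treeF_freeFO (X : ℕ) : (treeF X : MSOL AP).freeFO = ∅ := by
  ext n
  simp [treeF, freeFO_all, freeFO_imp, MSOL.freeFO]
  omega

lemma treeF_freeSO (X : ℕ) : (treeF X : MSOL AP).freeSO = {X} := by
  ext n
  simp [treeF, freeSO_all, freeSO_imp, MSOL.freeSO]

lemma sat_treeF (D : SODom) (K : KripkeTree AP) (V1 V2 X) (hX : V2 X ⊆ K.T) :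
    Sat D K V1 V2 (treeF X) ↔ IsTree (V2 X) := by
  have hT := (rooted_iff _ _).1 K.rooted
  simp only [treeF, Sat, sat_all, sat_imp, IsTree, rooted_iff]
  simp [Function.update]
  constructor
  · rintro ⟨r, hr, hrX, h⟩
    refine ⟨r, hrX, fun y hy => ⟨(h y (hX hy) hy).1.2.2, fun z hz hzy => ?_⟩⟩
    have hz' : z ∈ K.T := (hT.2 y (hX hy)).2 z ((hT.2 r hr).1.trans hz) hzy
    exact (h y (hX hy) hy).2 z hz' hr hz' hz hz' (hX hy) hzy
  · rintro ⟨r, hrX, h⟩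
    refine ⟨r, hX hrX, hrX, fun y hyT hy => ⟨⟨hX hrX, hyT, (h y hy).1⟩, ?_⟩⟩
    intro z hz _ _ hrz _ _ hzy
    exact (h y hy).2 z hrz hzy

def tr : MSOL AP → MSOL AP
  | .atom a x => .atom a x
  | .le x y => .le x y
  | .mem x X => .mem x X
  | .not φ => .not (tr φ)
  | .and φ ψ => .and (tr φ) (tr ψ)
  | .exFO x φ => .exFO x (tr φ)
  | .exSO X φ => .exSO X (.and (treeF X) (tr φ))

lemma tr_freeFO (φ : MSOL AP) : (tr φ).freeFO = φ.freeFO := by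
  induction φ <;> simp_all [tr, MSOL.freeFO, treeF_freeFO]

lemma tr_freeSO (φ : MSOL AP) : (tr φ).freeSO = φ.freeSO := by
  induction φ <;> simp_all [tr, MSOL.freeSO, treeF_freeSO]

lemma sat_tr (K : KripkeTree AP) (φ : MSOL AP) : ∀ V1 V2,
    Sat (weakDom MTLdom) K V1 V2 φ ↔ Sat (weakDom MSOdom) K V1 V2 (tr φ) := by
  induction φ with
  | atom a x => intros; rfl
  | le x y => intros; rfl
  | mem x X => intros; rfl
  | not φ ih => intro V1 V2; simp only [tr, Sat, ih]
  | and φ ψ ih1 ih2 => intro V1 V2; simp only [tr, Sat, ih1, ih2]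
  | exFO x φ ih => intro V1 V2; simp only [tr, Sat, ih]
  | exSO X φ ih =>
    intro V1 V2
    simp only [tr, Sat, ih]
    constructor
    · rintro ⟨S, ⟨⟨h1, h2⟩, h3⟩, h⟩
      refine ⟨S, ⟨h1, h3⟩, ?_, h⟩
      rw [sat_treeF] <;> simpa
    · rintro ⟨S, ⟨h1, h3⟩, h2, h⟩
      rw [sat_treeF _ _ _ _ _ (by rw [Function.update_self]; exact h1)] at h2
      exact ⟨S, ⟨⟨h1, by simpa using h2⟩, h3⟩, h⟩

lemma part1 : MLogic.Leq (finBrKT AP) (WMTL AP) (WMSO AP) := by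
  intro φ hφ _
  refine ⟨tr φ, ⟨by rw [tr_freeFO]; exact hφ.1, by rw [tr_freeSO]; exact hφ.2⟩, trivial, ?_⟩
  intro K _
  simp only [MLogic.KSat, WMTL, WMSO, sat_tr]

/-! coincidence -/
lemma sat_congr (D : SODom) (K : KripkeTree AP) (φ : MSOL AP) : ∀ V1 V2 V1' V2',
    (∀ x ∈ φ.freeFO, V1 x = V1' x) → (∀ X ∈ φ.freeSO, V2 X = V2' X) →
    (Sat D K V1 V2 φ ↔ Sat D K V1' V2' φ) := by
  induction φ with
  | atom a x => intro V1 V2 V1' V2' h1 h2; simp_all [Sat, MSOL.freeFO]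
  | le x y => intro V1 V2 V1' V2' h1 h2; simp_all [Sat, MSOL.freeFO]
  | mem x X => intro V1 V2 V1' V2' h1 h2; simp_all [Sat, MSOL.freeFO, MSOL.freeSO]
  | not φ ih => 
    intro V1 V2 V1' V2' h1 h2
    simp only [Sat, ih V1 V2 V1' V2' h1 h2]
  | and φ ψ ih1 ih2 =>
    intro V1 V2 V1' V2' h1 h2
    simp only [Sat, ih1 V1 V2 V1' V2' (fun x hx => h1 x (Or.inl hx)) (fun x hx => h2 x (Or.inl hx)),
      ih2 V1 V2 V1' V2' (fun x hx => h1 x (Or.inr hx)) (fun x hx => h2 x (Or.inr hx))]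
  | exFO x φ ih =>
    intro V1 V2 V1' V2' h1 h2
    simp only [Sat]
    refine exists_congr fun τ => and_congr_right fun _ => ih _ _ _ _ ?_ h2
    intro y hy
    by_cases hyx : y = x
    · simp [hyx]
    · simpa [hyx] using h1 y ⟨hy, hyx⟩
  | exSO x φ ih =>
    intro V1 V2 V1' V2' h1 h2
    simp only [Sat]
    refine exists_congr fun τ => and_congr_right fun _ => ih _ _ _ _ h1 ?_
    intro y hy
    by_cases hyx : y = x
    · simp [hyx]
    · simpa [hyx] using h2 y ⟨hy, hyx⟩

lemma ksat_iff (L : MLogic AP) (K : KripkeTree AP) (φ : MSOL AP) (h : φ.IsSentence) (V1 V2) :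
    L.KSat K φ ↔ Sat L.dom K V1 V2 φ := by
  constructor
  · rintro ⟨U1, U2, hU⟩
    refine (sat_congr _ _ _ _ _ _ _ ?_ ?_).1 hU
    · simp [h.1]
    · simp [h.2]
  · exact fun h => ⟨_, _, h⟩

/-! the trees -/
def nd (n : ℕ) (s : Bool) (p : ℕ) : Node :=
  (List.range p).map (fun i => if s = true ∧ i = n then 1 else 0)

lemma nd_length (n s p) : (nd n s p).length = p := by simp [nd]

lemma nd_take (n s p k) : (nd n s p).take k = nd n s (min k p) := by
  simp [nd, ← List.map_take, List.take_range]

lemma nd_eq {n s s' p p'} : nd n s p = nd n s' p' ↔ p = p' ∧ (s = s' ∨ p ≤ n) := by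
  constructor
  · intro h
    have hl : p = p' := by simpa [nd_length] using congrArg List.length h
    subst hl
    refine ⟨rfl, ?_⟩
    by_contra! hc
    have := congrArg (fun l => l[n]?) h
    simp [nd, hc.2] at this
    cases s <;> cases s' <;> simp_all
  · rintro ⟨rfl, h⟩
    rcases h with rfl | h
    · rfl
    · apply List.map_congr_left
      intro i hi
      have : i < p := by simpa using hi
      have : i ≠ n := by omega
      simp [this]

lemma nd_prefix {n s s' p p'} : nd n s p <+: nd n s' p' ↔ p ≤ p' ∧ (s = s' ∨ p ≤ n) := by
  rw [List.prefix_iff_eq_take, nd_length, nd_take, nd_eq]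
  constructor
  · rintro ⟨h1, h2⟩
    exact ⟨by omega, h2⟩
  · rintro ⟨h1, h2⟩
    exact ⟨by omega, h2⟩

lemma prefix_nd {n s p} {τ : Node} (h : τ <+: nd n s p) : ∃ q, q ≤ p ∧ τ = nd n s q := by
  rw [List.prefix_iff_eq_take, nd_take] at h
  exact ⟨_, min_le_right _ _, h⟩

lemma nd_snoc (n s p) : ∃ k, nd n s p ++ [k] = nd n s (p+1) := by
  refine ⟨if s = true ∧ p = n then 1 else 0, ?_⟩
  simp [nd, List.range_succ]

def TT (n : ℕ) : Set Node := {τ | ∃ s p, τ = nd n s p}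

lemma TT_prefix {n τ σ} (h : τ ∈ TT n) (h' : σ <+: τ) : σ ∈ TT n := by
  obtain ⟨s, p, rfl⟩ := h
  obtain ⟨q, _, rfl⟩ := prefix_nd h'
  exact ⟨s, q, rfl⟩

def KK (AP : Type) (n : ℕ) : KripkeTree AP where
  T := TT n
  root := []
  rooted := by
    rw [rooted_iff]
    refine ⟨⟨true, 0, rfl⟩, fun y hy => ⟨List.nil_prefix, fun z _ hz => TT_prefix hy hz⟩⟩
  nonblocking := by
    rintro τ ⟨s, p, rfl⟩
    obtain ⟨k, hk⟩ := nd_snoc n s p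
    exact ⟨k, s, p+1, hk⟩
  Lab := fun _ => ∅

lemma KK_fin (n : ℕ) : KK AP n ∈ finBrKT AP := by
  intro τ _
  refine Set.Finite.subset (s := {nd n true (τ.length+1), nd n false (τ.length+1)}) (by simp) ?_
  rintro τ' ⟨⟨s, p, rfl⟩, k, hk⟩
  have : p = τ.length + 1 := by simpa [nd_length] using congrArg List.length hk
  subst this
  cases s <;> simp

/-! positions -/
def Sim (d : ℕ) (R : Set (ℕ × ℕ)) : Prop :=
  ∀ a ∈ R, ∀ b ∈ R, min d (a.1 - b.1) = min d (a.2 - b.2)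

lemma Sim.mono {d d' R} (h : Sim d' R) (hd : d ≤ d') : Sim d R := by
  intro a ha b hb
  have := h a ha b hb
  omega

lemma sim_insert {d R p p'} (h : Sim d R)
    (hp : ∀ c ∈ R, min d (c.1 - p) = min d (c.2 - p') ∧ min d (p - c.1) = min d (p' - c.2)) :
    Sim d (insert (p, p') R) := by
  rintro a (rfl | ha) b (rfl | hb)
  · simp
  · exact (hp b hb).2
  · exact (hp a ha).1
  · exact h a ha b hb

lemma sim_ext {d R} (hd : 1 ≤ d) (h : Sim (2*d) R) (h0 : (0,0) ∈ R) (p : ℕ) :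
    ∃ p', Sim d (insert (p, p') R) := by
  by_cases h1 : ∃ a ∈ R, a.1 ≤ p ∧ p - a.1 ≤ d
  · obtain ⟨a, ha, h1, h2⟩ := h1
    refine ⟨a.2 + (p - a.1), sim_insert (h.mono (by omega)) fun c hc => ?_⟩
    have e1 := h a ha c hc
    have e2 := h c hc a ha
    omega
  by_cases h2 : ∃ a ∈ R, p ≤ a.1 ∧ a.1 - p ≤ d
  · obtain ⟨a, ha, h1, h2⟩ := h2
    refine ⟨a.2 - (a.1 - p), sim_insert (h.mono (by omega)) fun c hc => ?_⟩
    have e1 := h a ha c hc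
    have e2 := h c hc a ha
    have e3 := h a ha _ h0
    simp only at e3
    omega
  push Not at h1 h2
  have hex : ∃ a ∈ R, a.1 ≤ p ∧ ∀ c ∈ R, c.1 ≤ p → c.1 ≤ a.1 := by
    classical
    have hP : ∃ k, ∃ a ∈ R, a.1 ≤ p ∧ p - a.1 = k := ⟨_, _, h0, Nat.zero_le _, rfl⟩
    obtain ⟨a, ha, hap, hk⟩ := Nat.find_spec hP
    refine ⟨a, ha, hap, fun c hc hcp => ?_⟩
    have := Nat.find_min' hP ⟨c, hc, hcp, rfl⟩
    omega
  obtain ⟨a, ha, hap, hmax⟩ := hex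
  refine ⟨a.2 + d, sim_insert (h.mono (by omega)) fun c hc => ?_⟩
  have e1 := h a ha c hc
  have e2 := h c hc a ha
  have e3 := hmax c hc
  have e4 := h1 c hc
  have e5 := h2 c hc
  have e6 := h1 a ha hap
  omega

def st (r a b : Node) : Set Node := {τ | r <+: τ ∧ (τ <+: a ∨ τ <+: b)}

lemma st_dom {n} {r a b : Node} (ha : a ∈ TT n) (hb : b ∈ TT n) (h : r <+: a) :
    st r a b ∈ weakDom MTLdom (TT n) := by
  refine ⟨⟨?_, r, ?_⟩, ?_⟩
  · rintro τ ⟨_, h | h⟩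
    · exact TT_prefix ha h
    · exact TT_prefix hb h
  · rw [rooted_iff]
    refine ⟨⟨List.prefix_rfl, Or.inl h⟩, ?_⟩
    rintro y ⟨h1, h2⟩
    exact ⟨h1, fun z hz hzy => ⟨hz, h2.imp hzy.trans hzy.trans⟩⟩
  · refine Set.Finite.subset (List.finite_toSet (a.inits ++ b.inits)) ?_
    rintro τ ⟨_, h⟩
    simpa using h

lemma dom_st {n} {S : Set Node} (h : S ∈ weakDom MTLdom (TT n)) :
    ∃ r ∈ TT n, ∃ a ∈ TT n, ∃ b ∈ TT n, r <+: a ∧ S = st r a b := by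
  obtain ⟨⟨hST, r, hr⟩, hf⟩ := h
  rw [rooted_iff] at hr
  have key : ∀ s, ∃ c ∈ S, ∀ p, nd n s p ∈ S → nd n s p <+: c := by
    intro s
    by_cases hs : ∃ p, nd n s p ∈ S
    · have hfin : {p | nd n s p ∈ S}.Finite := by
        refine Set.Finite.preimage (f := nd n s) ?_ hf
        intro p _ q _ hpq
        exact (nd_eq.1 hpq).1
      obtain ⟨p, hp, hmax⟩ := Set.exists_max_image _ id hfin hs
      exact ⟨_, hp, fun q hq => nd_prefix.2 ⟨hmax q hq, Or.inl rfl⟩⟩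
    · push Not at hs
      exact ⟨r, hr.1, fun p hp => absurd hp (hs p)⟩
  obtain ⟨a, ha, ha'⟩ := key false
  obtain ⟨b, hb, hb'⟩ := key true
  refine ⟨r, hST hr.1, a, hST ha, b, hST hb, (hr.2 a ha).1, ?_⟩
  ext τ
  constructor
  · intro hτ
    refine ⟨(hr.2 τ hτ).1, ?_⟩
    obtain ⟨s, p, rfl⟩ := hST hτ
    cases s
    · exact Or.inl (ha' p hτ)
    · exact Or.inr (hb' p hτ)
  · rintro ⟨h1, h2 | h2⟩
    · exact (hr.2 a ha).2 τ h1 h2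
    · exact (hr.2 b hb).2 τ h1 h2

/-- corresponding nodes -/
def Cor (n m : ℕ) (R : Set (ℕ × ℕ)) (x y : Node) : Prop :=
  ∃ s p p', (p, p') ∈ R ∧ x = nd n s p ∧ y = nd m s p'

lemma Cor.mono {n m R R' x y} (h : Cor n m R x y) (hR : R ⊆ R') : Cor n m R' x y := by
  obtain ⟨s, p, p', h1, h2⟩ := h
  exact ⟨s, p, p', hR h1, h2⟩

lemma Cor.le_iff {n m d R x y x' y'} (hd : 1 ≤ d) (hR : Sim d R) (hn : (n, m) ∈ R)
    (h : Cor n m R x x') (h' : Cor n m R y y') : x <+: y ↔ x' <+: y' := by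
  obtain ⟨s, p, p', h1, rfl, rfl⟩ := h
  obtain ⟨t, q, q', h2, rfl, rfl⟩ := h'
  rw [nd_prefix, nd_prefix]
  have e1 := hR _ h1 _ h2
  have e2 := hR _ h1 _ hn
  simp only at e1 e2
  have f1 : p ≤ q ↔ p' ≤ q' := by omega
  have f2 : p ≤ n ↔ p' ≤ m := by omega
  rw [f1, f2]

structure Good (d n m : ℕ) (R : Set (ℕ × ℕ)) (V1 V1' : ℕ → Node) (V2 V2' : ℕ → Set Node) :
    Prop where
  sim : Sim d R
  zero : (0, 0) ∈ R
  br : (n, m) ∈ R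
  fo : ∀ x, Cor n m R (V1 x) (V1' x)
  so : ∀ X, ∃ r a b r' a' b', Cor n m R r r' ∧ Cor n m R a a' ∧ Cor n m R b b' ∧
    V2 X = st r a b ∧ V2' X = st r' a' b'

lemma Good.mono {d d' n m R V1 V1' V2 V2'} (h : Good d' n m R V1 V1' V2 V2') (hd : d ≤ d') :
    Good d n m R V1 V1' V2 V2' := { h with sim := h.sim.mono hd }

lemma Cor.swap {n m R x y} (h : Cor n m R x y) : Cor m n (Prod.swap ⁻¹' R) y x := by
  obtain ⟨s, p, p', h1, h2, h3⟩ := h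
  exact ⟨s, p', p, h1, h3, h2⟩

lemma Good.swap {d n m R V1 V1' V2 V2'} (h : Good d n m R V1 V1' V2 V2') :
    Good d m n (Prod.swap ⁻¹' R) V1' V1 V2' V2 where
  sim := fun a ha b hb => (h.sim _ ha _ hb).symm
  zero := h.zero
  br := h.br
  fo := fun x => (h.fo x).swap
  so := fun X => by
    obtain ⟨r, a, b, r', a', b', h1, h2, h3, h4, h5⟩ := h.so X
    exact ⟨r', a', b', r, a, b, h1.swap, h2.swap, h3.swap, h5, h4⟩

lemma Good.ext {d n m R V1 V1' V2 V2'} (hd : 1 ≤ d) (h : Good (2*d) n m R V1 V1' V2 V2')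
    {x : Node} (hx : x ∈ TT n) : ∃ R' x', R ⊆ R' ∧ x' ∈ TT m ∧ Cor n m R' x x' ∧
      Good d n m R' V1 V1' V2 V2' := by
  obtain ⟨s, p, rfl⟩ := hx
  obtain ⟨p', hp'⟩ := sim_ext hd h.sim h.zero p
  have hsub : R ⊆ insert (p, p') R := Set.subset_insert _ _
  refine ⟨insert (p, p') R, nd m s p', hsub, ⟨_, _, rfl⟩,
    ⟨s, p, p', Set.mem_insert _ _, rfl, rfl⟩, hp', hsub h.zero, hsub h.br,
    fun x => (h.fo x).mono hsub, fun X => ?_⟩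
  obtain ⟨r, a, b, r', a', b', h1, h2, h3, h4⟩ := h.so X
  exact ⟨r, a, b, r', a', b', h1.mono hsub, h2.mono hsub, h3.mono hsub, h4⟩

lemma Good.updFO {d n m R V1 V1' V2 V2'} (h : Good d n m R V1 V1' V2 V2') {x y y'}
    (hy : Cor n m R y y') :
    Good d n m R (Function.update V1 x y) (Function.update V1' x y') V2 V2' :=
  { h with
    fo := fun z => by
      by_cases hz : z = x
      · subst hz; simpa using hy
      · simpa [hz] using h.fo z }

lemma Good.updSO {d n m R V1 V1' V2 V2'} (h : Good d n m R V1 V1' V2 V2') {X r a b r' a' b'}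
    (h1 : Cor n m R r r') (h2 : Cor n m R a a') (h3 : Cor n m R b b') :
    Good d n m R V1 V1' (Function.update V2 X (st r a b)) (Function.update V2' X (st r' a' b')) :=
  { h with
    so := fun Y => by
      by_cases hY : Y = X
      · subst hY; exact ⟨r, a, b, r', a', b', h1, h2, h3, by simp, by simp⟩
      · simpa [hY] using h.so Y }

def rk : MSOL AP → ℕ
  | .atom _ _ => 1
  | .le _ _ => 1
  | .mem _ _ => 1
  | .not φ => rk φ
  | .and φ ψ => max (rk φ) (rk ψ)
  | .exFO _ φ => 2 * rk φ
  | .exSO _ φ => 2 * (2 * (2 * rk φ))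

lemma rk_pos (φ : MSOL AP) : 1 ≤ rk φ := by
  induction φ <;> simp only [rk] <;> omega

lemma Cor.mem_left {n m R x y} (h : Cor n m R x y) : x ∈ TT n := by
  obtain ⟨s, p, p', h1, h2, h3⟩ := h
  exact ⟨s, p, h2⟩

lemma game (φ : MSOL AP) : ∀ n m R V1 V1' V2 V2', Good (rk φ) n m R V1 V1' V2 V2' →
    Sat (weakDom MTLdom) (KK AP n) V1 V2 φ → Sat (weakDom MTLdom) (KK AP m) V1' V2' φ := by
  induction φ with
  | atom a x =>
    intro n m R V1 V1' V2 V2' h hs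
    simp [Sat, KK] at hs
  | le x y =>
    intro n m R V1 V1' V2 V2' h hs
    exact ⟨(h.fo x).swap.mem_left, (h.fo y).swap.mem_left,
      (Cor.le_iff (le_refl _) h.sim h.br (h.fo x) (h.fo y)).1 hs.2.2⟩
  | mem x X =>
    intro n m R V1 V1' V2 V2' h hs
    obtain ⟨r, a, b, r', a', b', h1, h2, h3, h4, h5⟩ := h.so X
    simp only [Sat, h4, h5, st, Set.mem_setOf_eq] at hs ⊢
    rw [Cor.le_iff (le_refl _) h.sim h.br (h.fo x) h2,
      Cor.le_iff (le_refl _) h.sim h.br (h.fo x) h3,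
      Cor.le_iff (le_refl _) h.sim h.br h1 (h.fo x)] at hs
    exact hs
  | not φ ih =>
    intro n m R V1 V1' V2 V2' h hs hs'
    exact hs (ih m n _ _ _ _ _ h.swap hs')
  | and φ ψ ih1 ih2 =>
    intro n m R V1 V1' V2 V2' h hs
    exact ⟨ih1 _ _ _ _ _ _ _ (h.mono (le_max_left _ _)) hs.1,
      ih2 _ _ _ _ _ _ _ (h.mono (le_max_right _ _)) hs.2⟩
  | exFO x φ ih =>
    rintro n m R V1 V1' V2 V2' h ⟨τ, hτ, hs⟩
    obtain ⟨R', τ', hR, hτ', hc, hg⟩ := Good.ext (rk_pos φ) h hτ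
    exact ⟨τ', hτ', ih _ _ _ _ _ _ _ (hg.updFO hc) hs⟩
  | exSO X φ ih =>
    rintro n m R V1 V1' V2 V2' h ⟨S, hS, hs⟩
    obtain ⟨r, hr, a, ha, b, hb, hra, rfl⟩ := dom_st hS
    have hp := rk_pos φ
    obtain ⟨R1, r', hR1, hr', hcr, hg⟩ := Good.ext (by omega) h hr
    obtain ⟨R2, a', hR2, ha', hca, hg⟩ := Good.ext (by omega) hg ha
    obtain ⟨R3, b', hR3, hb', hcb, hg⟩ := Good.ext (by omega) hg hb
    have hcr := (hcr.mono hR2).mono hR3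
    have hca := hca.mono hR3
    refine ⟨st r' a' b', st_dom ha' hb' ?_, ih _ _ _ _ _ _ _ (hg.updSO hcr hca hcb) hs⟩
    exact (Cor.le_iff hp hg.sim hg.br hcr hca).1 hra

lemma indist (φ : MSOL AP) (hφ : φ.IsSentence) (n m : ℕ) (hn : rk φ ≤ n) (hm : rk φ ≤ m) :
    (WMTL AP).KSat (KK AP n) φ → (WMTL AP).KSat (KK AP m) φ := by
  rw [ksat_iff _ _ _ hφ (fun _ => []) (fun _ => st [] [] []),
    ksat_iff _ _ _ hφ (fun _ => []) (fun _ => st [] [] [])]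
  have hc : Cor n m {(0, 0), (n, m)} [] [] := ⟨true, 0, 0, by simp, rfl, rfl⟩
  apply game φ n m {(0, 0), (n, m)}
  refine ⟨?_, by simp, by simp, fun _ => hc, fun _ => ⟨_, _, _, _, _, _, hc, hc, hc, rfl, rfl⟩⟩
  rintro a (rfl | rfl) b (rfl | rfl) <;> simp <;> omega

/-! the separating sentence -/
/-- variable x is comparable with everything (uses variable 5) -/
def compF (x : ℕ) : MSOL AP := all 5 (imp (.not (.le x 5)) (.le 5 x))
def rootF : MSOL AP := all 5 (.le 0 5)
def lastF : MSOL AP := .and (compF 0) (all 2 (imp (compF 2) (.le 2 0)))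
def childF : MSOL AP := .and (.not (.le 1 0)) (.and (.le 0 1)
  (all 2 (imp (.le 0 2) (imp (.le 2 1) (imp (.not (.le 2 0)) (.le 1 2))))))
def iffF (φ ψ : MSOL AP) : MSOL AP := .and (imp φ ψ) (imp ψ φ)
def evenF : MSOL AP := .exSO 0 (.and (all 0 (imp rootF (.mem 0 0)))
  (.and (all 0 (imp lastF (.mem 0 0)))
    (all 0 (all 1 (imp (compF 1) (imp childF (iffF (.mem 0 0) (.not (.mem 1 0)))))))))

lemma evenF_sentence : (evenF : MSOL AP).IsSentence := by
  constructor
  · ext n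
    simp [evenF, compF, rootF, lastF, childF, iffF, freeFO_all, freeFO_imp, MSOL.freeFO]
    omega
  · ext n
    simp [evenF, compF, rootF, lastF, childF, iffF, freeSO_all, freeSO_imp, MSOL.freeSO]

lemma forall_TT {n : ℕ} {P : Node → Prop} : (∀ τ ∈ TT n, P τ) ↔ ∀ s p, P (nd n s p) := by
  constructor
  · exact fun h s p => h _ ⟨s, p, rfl⟩
  · rintro h _ ⟨s, p, rfl⟩
    exact h s p

lemma nd_mem (n s p) : nd n s p ∈ TT n := ⟨s, p, rfl⟩

lemma sat_comp (D : SODom) (n : ℕ) (V1 V2 x s p) (hx : x ≠ 5) (h : V1 x = nd n s p) :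
    Sat D (KK AP n) V1 V2 (compF x) ↔ p ≤ n := by
  simp only [compF, sat_all, sat_imp, Sat]
  change (∀ τ ∈ TT n, _) ↔ _
  rw [forall_TT]
  simp only [Function.update_self, Function.update_of_ne hx, h, KK, nd_mem, true_and, nd_prefix]
  constructor
  · intro hh
    by_contra! hc
    have := hh (!s) p
    cases s <;> simp at this <;> omega
  · intro hp t q hh
    by_cases hq : q ≤ p
    · exact ⟨hq, Or.inr (by omega)⟩
    · exact absurd ⟨by omega, Or.inr hp⟩ hh

lemma sat_root (D : SODom) (n : ℕ) (V1 V2 s p) (h : V1 0 = nd n s p) :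
    Sat D (KK AP n) V1 V2 rootF ↔ p = 0 := by
  simp only [rootF, sat_all, Sat]
  change (∀ τ ∈ TT n, _) ↔ _
  rw [forall_TT]
  simp [-Bool.forall_bool, Function.update, h, KK, nd_mem, nd_prefix]
  constructor
  · intro hh
    exact Nat.le_zero.1 (hh true 0).1
  · rintro rfl; simp

lemma sat_last (D : SODom) (n : ℕ) (V1 V2 s p) (h : V1 0 = nd n s p) :
    Sat D (KK AP n) V1 V2 lastF ↔ p = n := by
  simp only [lastF, sat_all, sat_imp, Sat]
  rw [sat_comp D n V1 V2 0 s p (by simp) h]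
  change (_ ∧ ∀ τ ∈ TT n, _) ↔ _
  rw [forall_TT]
  have : ∀ t q, Sat D (KK AP n) (Function.update V1 2 (nd n t q)) V2 (compF 2) ↔ q ≤ n :=
    fun t q => sat_comp D n _ V2 2 t q (by simp) (by simp)
  simp only [this]
  simp [-Bool.forall_bool, Function.update, h, KK, nd_mem, nd_prefix]
  constructor
  · rintro ⟨h1, h2⟩
    have := (h2 s n le_rfl).1
    omega
  · rintro rfl
    exact ⟨le_rfl, fun t q hq => ⟨hq, Or.inr hq⟩⟩

lemma sat_child (D : SODom) (n : ℕ) (V1 V2 s p t q) (h : V1 0 = nd n s p) (h' : V1 1 = nd n t q)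
    (hq : q ≤ n) :
    Sat D (KK AP n) V1 V2 childF ↔ q = p + 1 := by
  simp only [childF, sat_all, sat_imp, Sat]
  change (_ ∧ _ ∧ ∀ τ ∈ TT n, _) ↔ _
  rw [forall_TT]
  simp [-Bool.forall_bool, Function.update, h, h', KK, nd_mem, nd_prefix, hq]
  constructor
  · rintro ⟨h1, ⟨h2, _⟩, h3⟩
    by_contra hc
    have := h3 t (p+1) (by omega) (Or.inr (by omega)) (by omega) (Or.inl rfl) (by omega)
    omega
  · rintro rfl
    refine ⟨by omega, ⟨by omega, Or.inr (by omega)⟩, ?_⟩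
    intro u k h1 h2 h3 h4 h5
    by_contra hc
    have := h5 (by omega)
    omega

lemma sat_even (n : ℕ) : (WMSO AP).KSat (KK AP n) evenF ↔ Even n := by
  rw [ksat_iff _ _ _ evenF_sentence (fun _ => []) (fun _ => ∅)]
  have key : ∀ S : Set Node, Sat (weakDom MSOdom) (KK AP n) (fun _ => [])
      (Function.update (fun _ => ∅) 0 S) (.and (all 0 (imp rootF (.mem 0 0)))
        (.and (all 0 (imp lastF (.mem 0 0)))
        (all 0 (all 1 (imp (compF 1) (imp childF (iffF (.mem 0 0) (.not (.mem 1 0))))))))) ↔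
      nd n true 0 ∈ S ∧ nd n true n ∈ S ∧
        ∀ p, p + 1 ≤ n → (nd n true p ∈ S ↔ nd n true (p+1) ∉ S) := by
    intro S
    have tt : ∀ s p, p ≤ n → nd n s p = nd n true p := fun s p h => nd_eq.2 ⟨rfl, Or.inr h⟩
    simp only [Sat, sat_all, sat_imp, iffF]
    change ((∀ τ ∈ TT n, _) ∧ (∀ τ ∈ TT n, _) ∧ ∀ τ ∈ TT n, ∀ τ' ∈ TT n, _) ↔ _
    simp only [forall_TT]
    have a1 : ∀ (V : ℕ → Node) (W : ℕ → Set Node) s p, Sat (weakDom MSOdom) (KK AP n)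
      (Function.update V 0 (nd n s p)) W rootF ↔ p = 0 :=
      fun V W s p => sat_root _ _ _ _ s p (by simp)
    have a2 : ∀ (V : ℕ → Node) (W : ℕ → Set Node) s p, Sat (weakDom MSOdom) (KK AP n)
      (Function.update V 0 (nd n s p)) W lastF ↔ p = n :=
      fun V W s p => sat_last _ _ _ _ s p (by simp)
    have a3 : ∀ (V : ℕ → Node) (W : ℕ → Set Node) s p, Sat (weakDom MSOdom) (KK AP n)
      (Function.update V 1 (nd n s p)) W (compF 1) ↔ p ≤ n :=
      fun V W s p => sat_comp _ _ _ _ _ s p (by simp) (by simp)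
    simp only [a1, a2, a3]
    refine and_congr ?_ (and_congr ?_ ?_)
    · constructor
      · intro h; simpa using h true 0 rfl
      · rintro h s p rfl
        simpa [tt s 0 (by omega)] using h
    · constructor
      · intro h; simpa using h true n rfl
      · rintro h s p rfl
        simpa [tt s p le_rfl] using h
    · constructor
      · intro h p hp
        have := h true p true (p+1) hp
          ((sat_child _ n _ _ true p true (p+1) (by simp) (by simp) hp).2 rfl)
        simp [Function.update] at this
        tauto
      · intro h s p t q hq hc
        rw [sat_child _ n _ _ s p t q (by simp) (by simp) hq] at hc
        subst hc
        have := h p hq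
        simp [Function.update, tt s p (by omega), tt t (p+1) hq]
        tauto
  change (∃ S ∈ weakDom MSOdom (TT n), _) ↔ _
  simp only [WMSO, key]
  constructor
  · rintro ⟨S, -, h0, hn, h⟩
    have : ∀ p, p ≤ n → (nd n true p ∈ S ↔ Even p) := by
      intro p
      induction p with
      | zero => simp [h0]
      | succ p ih =>
        intro hp
        have h1 := ih (by omega)
        have h2 := h p hp
        rw [Nat.even_add_one]
        tauto
    exact (this n le_rfl).1 hn
  · intro hn
    have hm : ∀ p, nd n true p ∈ (nd n true '' {p | p ≤ n ∧ Even p}) ↔ (p ≤ n ∧ Even p) := by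
      intro p
      constructor
      · rintro ⟨q, hq, hqp⟩
        rw [← (nd_eq.1 hqp).1]
        exact hq
      · exact fun h => ⟨p, h, rfl⟩
    refine ⟨nd n true '' {p | p ≤ n ∧ Even p}, ⟨?_, ?_⟩, ?_, ?_, ?_⟩
    · rintro _ ⟨p, _, rfl⟩
      exact nd_mem _ _ _
    · exact ((Set.finite_Iic n).subset fun p hp => hp.1).image _
    · rw [hm]; simp
    · rw [hm]; exact ⟨le_rfl, hn⟩
    · intro p hp
      rw [hm, hm, Nat.even_add_one]
      have : p ≤ n := by omega
      tauto

lemma part2 : ¬ MLogic.Leq (finBrKT AP) (WMSO AP) (WMTL AP) := by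
  intro h
  obtain ⟨φ, hφ, -, hh⟩ := h evenF evenF_sentence trivial
  have h1 := hh _ (KK_fin (2 * rk φ))
  have h2 := hh _ (KK_fin (2 * rk φ + 1))
  rw [sat_even] at h1 h2
  have := h2.2 (indist φ hφ _ _ (by omega) (by omega) (h1.1 (by simp)))
  simp [Nat.even_add_one] at this

end Aux

/-- WMTL < WMSO, even over finitely-branching Kripke trees. -/
theorem stmt5 (AP : Type) [Fintype AP] :
    MLogic.Leq (finBrKT AP) (WMTL AP) (WMSO AP) ∧
    ¬ MLogic.Leq (finBrKT AP) (WMSO AP) (WMTL AP) := by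
  exact ⟨Aux.part1, Aux.part2⟩
end
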